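/- Let Ω = D(0,R) ⊂ ℝ² be the open disc of radius R > 0 centred at the origin, and let B be a continuous radial magnetic field on closure(Ω), i.e. B(x) = b(|x|) for some continuous b : [0,R] → ℝ. Let ψ₀ be the scalar potential of B on Ω. Then lim_{h→0⁺} h·log Λ^D(h,B,Ω) = −2·Osc_Ω ψ₀, where Osc_Ω ψ₀ := sup_Ω ψ₀ − inf_Ω ψ₀. -/

import Mathlib

open MeasureTheory Set Filter Topology

noncomputable section

/-- First partial derivative (in the direction `x₁`) of a function on `ℝ × ℝ`. -/
def pd1 {E : Type*} [NormedAddCommGroup E] [NormedSpace ℝ E] (u : ℝ × ℝ → E) (x : ℝ × ℝ) : E :=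
  fderiv ℝ u x (1, 0)

/-- Second partial derivative (in the direction `x₂`) of a function on `ℝ × ℝ`. -/
def pd2 {E : Type*} [NormedAddCommGroup E] [NormedSpace ℝ E] (u : ℝ × ℝ → E) (x : ℝ × ℝ) : E :=
  fderiv ℝ u x (0, 1)

/-- The Laplacian on `ℝ × ℝ`. -/
def lap (ψ : ℝ × ℝ → ℝ) (x : ℝ × ℝ) : ℝ := pd1 (pd1 ψ) x + pd2 (pd2 ψ) x

/-- Test functions for the Dirichlet variational problems on `Ω`:
nonzero smooth compactly supported functions with support in `Ω`. -/
def IsTestFun (Ω : Set (ℝ × ℝ)) (u : ℝ × ℝ → ℂ) : Prop :=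
  ContDiff ℝ (⊤ : ℕ∞) u ∧ HasCompactSupport u ∧ tsupport u ⊆ Ω ∧ u ≠ 0

/-- Rayleigh quotient of the spin-`σ` (`σ = -1` : spin-down, `σ = 1` : spin-up)
Dirichlet Pauli operator at the test function `u`. -/
def pauliRayleigh (σ : ℝ) (h : ℝ) (A : ℝ × ℝ → ℝ × ℝ) (B : ℝ × ℝ → ℝ) (Ω : Set (ℝ × ℝ))
    (u : ℝ × ℝ → ℂ) : ℝ :=
  ((∫ x in Ω, (‖(h : ℂ) * pd1 u x - Complex.I * ((A x).1 : ℂ) * u x‖ ^ 2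
      + ‖(h : ℂ) * pd2 u x - Complex.I * ((A x).2 : ℂ) * u x‖ ^ 2))
    + σ * (h * ∫ x in Ω, B x * ‖u x‖ ^ 2)) / ∫ x in Ω, ‖u x‖ ^ 2

/-- The ground state energy `λ₋^D(h,A,B,Ω)` of the spin-down Dirichlet Pauli operator. -/
def lambdaMinusD (h : ℝ) (A : ℝ × ℝ → ℝ × ℝ) (B : ℝ × ℝ → ℝ) (Ω : Set (ℝ × ℝ)) : ℝ :=
  sInf (pauliRayleigh (-1) h A B Ω '' {u | IsTestFun Ω u})

/-- The ground state energy `λ₊^D(h,A,B,Ω)` of the spin-up Dirichlet Pauli operator. -/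
def lambdaPlusD (h : ℝ) (A : ℝ × ℝ → ℝ × ℝ) (B : ℝ × ℝ → ℝ) (Ω : Set (ℝ × ℝ)) : ℝ :=
  sInf (pauliRayleigh 1 h A B Ω '' {u | IsTestFun Ω u})

/-- The ground state energy `Λ^D(h,A,B,Ω)` of the full Dirichlet Pauli operator. -/
def LambdaD (h : ℝ) (A : ℝ × ℝ → ℝ × ℝ) (B : ℝ × ℝ → ℝ) (Ω : Set (ℝ × ℝ)) : ℝ :=
  min (lambdaMinusD h A B Ω) (lambdaPlusD h A B Ω)

/-- The canonical vector potential `∇⊥ψ = (−∂₂ψ, ∂₁ψ)`. -/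
def perpGrad (ψ : ℝ × ℝ → ℝ) (x : ℝ × ℝ) : ℝ × ℝ := (-(pd2 ψ x), pd1 ψ x)

/-- `ψ` is the scalar potential of `B` on `Ω`: `ψ ∈ C⁰(closure Ω) ∩ C²(Ω)`,
`Δψ = B` in `Ω` and `ψ = 0` on `∂Ω`. -/
structure IsScalarPotential (Ω : Set (ℝ × ℝ)) (B : ℝ × ℝ → ℝ) (ψ : ℝ × ℝ → ℝ) : Prop where
  contOn : ContinuousOn ψ (closure Ω)
  c2 : ContDiffOn ℝ 2 ψ Ω
  lap_eq : ∀ x ∈ Ω, lap ψ x = B x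
  bdry : ∀ x ∈ frontier Ω, ψ x = 0

/-- `A` is a continuous vector potential for `B` on `Ω`: `∂₁A₂ − ∂₂A₁ = B`. -/
def IsVectorPotential (Ω : Set (ℝ × ℝ)) (B : ℝ × ℝ → ℝ) (A : ℝ × ℝ → ℝ × ℝ) : Prop :=
  ContinuousOn A Ω ∧ ∀ x ∈ Ω, pd1 (fun y => (A y).2) x - pd2 (fun y => (A y).1) x = B x

/-- `γ` is a regular curve of class `C^{2,α}` on the parameter set `s`. -/
def C2HolderOn (α : ℝ) (γ : ℝ → ℝ × ℝ) (s : Set ℝ) : Prop :=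
  ContDiffOn ℝ 2 γ s ∧
  (∃ C : ℝ, ∀ x ∈ s, ∀ y ∈ s,
      ‖derivWithin (derivWithin γ s) s x - derivWithin (derivWithin γ s) s y‖ ≤ C * |x - y| ^ α) ∧
  ∀ x ∈ s, derivWithin γ s x ≠ 0

/-- Near `p`, the set `Γ` is a regular curve of class `C^{2,α}`. -/
def IsLocallyC2CurveAt (α : ℝ) (Γ : Set (ℝ × ℝ)) (p : ℝ × ℝ) : Prop :=
  ∃ ε > 0, ∃ γ : ℝ → ℝ × ℝ, C2HolderOn α γ (Icc (-1) 1) ∧ γ 0 = p ∧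
    Γ ∩ Metric.ball p ε = γ '' Ioo (-1) 1 ∩ Metric.ball p ε

/-- `Γ` is (locally) a regular curve of class `C^{2,α}`. -/
def IsC2HolderSet (α : ℝ) (Γ : Set (ℝ × ℝ)) : Prop := ∀ p ∈ Γ, IsLocallyC2CurveAt α Γ p

/-- `Ω` has a corner at `p` formed by two `C^{2,α}` arcs, of aperture less than `π`
(near `p`, `Ω` is contained in a strictly convex open cone with vertex `p`). -/
def HasConvexCornerAt (Ω : Set (ℝ × ℝ)) (α : ℝ) (p : ℝ × ℝ) : Prop :=
  ∃ ε > 0, (∃ γ₁ γ₂ : ℝ → ℝ × ℝ, C2HolderOn α γ₁ (Icc 0 1) ∧ C2HolderOn α γ₂ (Icc 0 1) ∧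
      γ₁ 0 = p ∧ γ₂ 0 = p ∧
      frontier Ω ∩ Metric.ball p ε = (γ₁ '' Ico 0 1 ∪ γ₂ '' Ico 0 1) ∩ Metric.ball p ε) ∧
    ∃ w : ℝ × ℝ, ∃ c > 0, ∀ x ∈ Ω ∩ Metric.ball p ε,
      c * ‖x - p‖ ≤ (x - p).1 * w.1 + (x - p).2 * w.2

/-- `Ω` has a continuous boundary which is piecewise of class `C^{2,α}` for some `α > 0`,
with at most finitely many corners, each of aperture less than `π`. -/
def HasPiecewiseC2Boundary (Ω : Set (ℝ × ℝ)) : Prop :=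
  ∃ α > 0, ∃ S : Finset (ℝ × ℝ), ↑S ⊆ frontier Ω ∧
    (∀ p ∈ frontier Ω \ (S : Set (ℝ × ℝ)), IsLocallyC2CurveAt α (frontier Ω) p) ∧
    ∀ p ∈ S, HasConvexCornerAt Ω α p

/-- Assumption (R): `Ω` is bounded and open with continuous, piecewise `C^{2,α}` boundary
having finitely many corners of aperture `< π`, and `B` extends continuously to `closure Ω`. -/
structure AssumptionR (Ω : Set (ℝ × ℝ)) (B : ℝ × ℝ → ℝ) : Prop where
  isOpen : IsOpen Ω
  bounded : Bornology.IsBounded Ω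
  bdryReg : HasPiecewiseC2Boundary Ω
  fieldCont : ContinuousOn B (closure Ω)

/-- The oscillation of `ψ` over `Ω`. -/
def osc (ψ : ℝ × ℝ → ℝ) (Ω : Set (ℝ × ℝ)) : ℝ := sSup (ψ '' Ω) - sInf (ψ '' Ω)

/-- The region enclosed by `Γ`: the union of the bounded connected components of `Γᶜ`. -/
def curveInterior (Γ : Set (ℝ × ℝ)) : Set (ℝ × ℝ) :=
  {x | x ∉ Γ ∧ Bornology.IsBounded (connectedComponentIn Γᶜ x)}

/-- `Γ` is a simple closed curve of class `C^{2,α}`. -/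
def IsC2ClosedCurve (α : ℝ) (Γ : Set (ℝ × ℝ)) : Prop :=
  ∃ γ : ℝ → ℝ × ℝ, Function.Periodic γ 1 ∧ C2HolderOn α γ (Icc 0 1) ∧
    InjOn γ (Ico 0 1) ∧ Γ = γ '' Icc 0 1

/-- The ground state energy `λ^D(Ω)` of the Dirichlet Laplacian on `Ω`. -/
def dirichletGSE (Ω : Set (ℝ × ℝ)) : ℝ :=
  sInf ((fun u : ℝ × ℝ → ℝ =>
      (∫ x in Ω, (pd1 u x ^ 2 + pd2 u x ^ 2)) / ∫ x in Ω, u x ^ 2) ''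
    {u | ContDiff ℝ (⊤ : ℕ∞) u ∧ HasCompactSupport u ∧ tsupport u ⊆ Ω ∧ u ≠ 0})

/-- The open disc of radius `R` centred at the origin (with the Euclidean distance). -/
def disc (R : ℝ) : Set (ℝ × ℝ) := {y : ℝ × ℝ | y.1 ^ 2 + y.2 ^ 2 < R ^ 2}

end

section PartialDerivatives

variable {E : Type*} [NormedAddCommGroup E] [NormedSpace ℝ E]

lemma contDiff_pd1 {u : ℝ × ℝ → E} (hu : ContDiff ℝ 2 u) : ContDiff ℝ 1 (pd1 u) :=
  (hu.fderiv_right (m := 1) (by norm_num)).clm_apply contDiff_const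

lemma contDiff_pd2 {u : ℝ × ℝ → E} (hu : ContDiff ℝ 2 u) : ContDiff ℝ 1 (pd2 u) :=
  (hu.fderiv_right (m := 1) (by norm_num)).clm_apply contDiff_const

lemma continuous_pd1 {u : ℝ × ℝ → E} (hu : ContDiff ℝ 1 u) : Continuous (pd1 u) :=
  (hu.continuous_fderiv (by norm_num)).clm_apply continuous_const

lemma continuous_pd2 {u : ℝ × ℝ → E} (hu : ContDiff ℝ 1 u) : Continuous (pd2 u) :=
  (hu.continuous_fderiv (by norm_num)).clm_apply continuous_const

lemma pd1_congr {f g : ℝ × ℝ → E} {x : ℝ × ℝ} (h : f =ᶠ[𝓝 x] g) : pd1 f x = pd1 g x := by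
  unfold pd1; rw [h.fderiv_eq]

lemma pd2_congr {f g : ℝ × ℝ → E} {x : ℝ × ℝ} (h : f =ᶠ[𝓝 x] g) : pd2 f x = pd2 g x := by
  unfold pd2; rw [h.fderiv_eq]

lemma pd1_eventuallyEq {f g : ℝ × ℝ → E} {x : ℝ × ℝ} (h : f =ᶠ[𝓝 x] g) :
    pd1 f =ᶠ[𝓝 x] pd1 g := by
  filter_upwards [h.eventually_nhds] with y hy using pd1_congr hy

lemma pd2_eventuallyEq {f g : ℝ × ℝ → E} {x : ℝ × ℝ} (h : f =ᶠ[𝓝 x] g) :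
    pd2 f =ᶠ[𝓝 x] pd2 g := by
  filter_upwards [h.eventually_nhds] with y hy using pd2_congr hy

lemma lap_congr {f g : ℝ × ℝ → ℝ} {x : ℝ × ℝ} (h : f =ᶠ[𝓝 x] g) : lap f x = lap g x := by
  unfold lap
  rw [pd1_congr (pd1_eventuallyEq h), pd2_congr (pd2_eventuallyEq h)]

lemma pd1_eq_zero_of_notMem_tsupport {u : ℝ × ℝ → E} {x : ℝ × ℝ} (hx : x ∉ tsupport u) :
    pd1 u x = 0 := by
  have := image_eq_zero_of_notMem_tsupport (fun h => hx (tsupport_fderiv_subset ℝ h))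
  simp [pd1, this]

lemma pd2_eq_zero_of_notMem_tsupport {u : ℝ × ℝ → E} {x : ℝ × ℝ} (hx : x ∉ tsupport u) :
    pd2 u x = 0 := by
  have := image_eq_zero_of_notMem_tsupport (fun h => hx (tsupport_fderiv_subset ℝ h))
  simp [pd2, this]

variable {f g : ℝ × ℝ → ℝ} {x : ℝ × ℝ}

lemma pd1_mul (hf : DifferentiableAt ℝ f x) (hg : DifferentiableAt ℝ g x) :
    pd1 (fun y => f y * g y) x = f x * pd1 g x + pd1 f x * g x := by
  unfold pd1; rw [fderiv_fun_mul hf hg]; simp [mul_comm]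

lemma pd2_mul (hf : DifferentiableAt ℝ f x) (hg : DifferentiableAt ℝ g x) :
    pd2 (fun y => f y * g y) x = f x * pd2 g x + pd2 f x * g x := by
  unfold pd2; rw [fderiv_fun_mul hf hg]; simp [mul_comm]

lemma pd1_add (hf : DifferentiableAt ℝ f x) (hg : DifferentiableAt ℝ g x) :
    pd1 (fun y => f y + g y) x = pd1 f x + pd1 g x := by
  unfold pd1; rw [fderiv_fun_add hf hg]; simp

lemma pd2_add (hf : DifferentiableAt ℝ f x) (hg : DifferentiableAt ℝ g x) :
    pd2 (fun y => f y + g y) x = pd2 f x + pd2 g x := by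
  unfold pd2; rw [fderiv_fun_add hf hg]; simp

lemma pd1_sub (hf : DifferentiableAt ℝ f x) (hg : DifferentiableAt ℝ g x) :
    pd1 (fun y => f y - g y) x = pd1 f x - pd1 g x := by
  unfold pd1; rw [fderiv_fun_sub hf hg]; simp

lemma pd2_sub (hf : DifferentiableAt ℝ f x) (hg : DifferentiableAt ℝ g x) :
    pd2 (fun y => f y - g y) x = pd2 f x - pd2 g x := by
  unfold pd2; rw [fderiv_fun_sub hf hg]; simp

lemma pd1_neg (f : ℝ × ℝ → ℝ) : pd1 (fun y => -f y) = fun y => -pd1 f y := by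
  funext x; unfold pd1; rw [fderiv_fun_neg]; simp

lemma pd2_neg (f : ℝ × ℝ → ℝ) : pd2 (fun y => -f y) = fun y => -pd2 f y := by
  funext x; unfold pd2; rw [fderiv_fun_neg]; simp

lemma lap_neg (f : ℝ × ℝ → ℝ) (x : ℝ × ℝ) : lap (fun y => -f y) x = -lap f x := by
  simp only [lap, pd1_neg, pd2_neg]; ring

lemma pd1_const_mul (c : ℝ) (hf : DifferentiableAt ℝ f x) :
    pd1 (fun y => c * f y) x = c * pd1 f x := by
  unfold pd1; rw [fderiv_const_mul hf]; simp

lemma pd2_const_mul (c : ℝ) (hf : DifferentiableAt ℝ f x) :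
    pd2 (fun y => c * f y) x = c * pd2 f x := by
  unfold pd2; rw [fderiv_const_mul hf]; simp

lemma pd1_exp (hf : DifferentiableAt ℝ f x) :
    pd1 (fun y => Real.exp (f y)) x = Real.exp (f x) * pd1 f x := by
  unfold pd1; rw [fderiv_exp hf]; simp

lemma pd2_exp (hf : DifferentiableAt ℝ f x) :
    pd2 (fun y => Real.exp (f y)) x = Real.exp (f x) * pd2 f x := by
  unfold pd2; rw [fderiv_exp hf]; simp

lemma pd1_fst (x : ℝ × ℝ) : pd1 (fun y : ℝ × ℝ => y.1) x = 1 := by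
  unfold pd1; rw [fderiv_fst]; simp

lemma pd1_pd2_comm (hf : ContDiffAt ℝ 2 f x) : pd1 (pd2 f) x = pd2 (pd1 f) x := by
  have hd : DifferentiableAt ℝ (fderiv ℝ f) x :=
    (hf.fderiv_right (m := 1) (by norm_num)).differentiableAt (by norm_num)
  have hs := hf.isSymmSndFDerivAt (by simp)
  have h1 : pd1 (pd2 f) x = fderiv ℝ (fderiv ℝ f) x (1, 0) (0, 1) := by
    unfold pd1 pd2
    rw [fderiv_clm_apply hd (by fun_prop)]; simp
  have h2 : pd2 (pd1 f) x = fderiv ℝ (fderiv ℝ f) x (0, 1) (1, 0) := by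
    unfold pd1 pd2
    rw [fderiv_clm_apply hd (by fun_prop)]; simp
  rw [h1, h2]; exact hs _ _

end PartialDerivatives

section Energy

lemma integrable_of_eq_zero_off_compact {K : Set (ℝ × ℝ)} (hK : IsCompact K) {f : ℝ × ℝ → ℝ}
    (hf : Continuous f) (h0 : ∀ x, x ∉ K → f x = 0) : Integrable f :=
  hf.integrable_of_hasCompactSupport (HasCompactSupport.intro hK h0)

lemma integral_pd1_eq_zero {f : ℝ × ℝ → ℝ} (hf : ContDiff ℝ 1 f) (hs : HasCompactSupport f) :
    ∫ x, pd1 f x = 0 := by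
  have hi : Integrable fun x => fderiv ℝ f x (1, 0) :=
    integrable_of_eq_zero_off_compact hs (continuous_pd1 hf)
      fun x hx => pd1_eq_zero_of_notMem_tsupport hx
  have := integral_mul_fderiv_eq_neg_fderiv_mul_of_integrable (μ := (volume : Measure (ℝ × ℝ)))
    (f := fun _ => (1 : ℝ)) (g := f) (v := (1, 0)) (by simp)
    (by simpa using hi)
    (by simpa using hf.continuous.integrable_of_hasCompactSupport hs) (by simp)
    (fun x _ => hf.differentiable (by norm_num) x)
  simpa [pd1] using this

lemma integral_pd2_eq_zero {f : ℝ × ℝ → ℝ} (hf : ContDiff ℝ 1 f) (hs : HasCompactSupport f) :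
    ∫ x, pd2 f x = 0 := by
  have hi : Integrable fun x => fderiv ℝ f x (0, 1) :=
    integrable_of_eq_zero_off_compact hs (continuous_pd2 hf)
      fun x hx => pd2_eq_zero_of_notMem_tsupport hx
  have := integral_mul_fderiv_eq_neg_fderiv_mul_of_integrable (μ := (volume : Measure (ℝ × ℝ)))
    (f := fun _ => (1 : ℝ)) (g := f) (v := (0, 1)) (by simp)
    (by simpa using hi)
    (by simpa using hf.continuous.integrable_of_hasCompactSupport hs) (by simp)
    (fun x _ => hf.differentiable (by norm_num) x)
  simpa [pd2] using this

lemma integral_add_divergence {Q F G : ℝ × ℝ → ℝ} (hQ : Integrable Q) (hF : ContDiff ℝ 1 F)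
    (hG : ContDiff ℝ 1 G) (sF : HasCompactSupport F) (sG : HasCompactSupport G) :
    ∫ x, (Q x + pd1 F x + pd2 G x) = ∫ x, Q x := by
  have iF : Integrable (pd1 F) := integrable_of_eq_zero_off_compact sF (continuous_pd1 hF)
    fun x hx => pd1_eq_zero_of_notMem_tsupport hx
  have iG : Integrable (pd2 G) := integrable_of_eq_zero_off_compact sG (continuous_pd2 hG)
    fun x hx => pd2_eq_zero_of_notMem_tsupport hx
  have i2 : Integrable fun x => Q x + pd1 F x := hQ.add iF
  rw [integral_add i2 iG, integral_add hQ iF, integral_pd1_eq_zero hF sF,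
    integral_pd2_eq_zero hG sG, add_zero, add_zero]

/-- The squared norm of `(h∂₁ + ∂₁φ + i(h∂₂ + ∂₂φ))(a + ib)`. -/
noncomputable def crDensity (h : ℝ) (φ a b : ℝ × ℝ → ℝ) (x : ℝ × ℝ) : ℝ :=
  (h * pd1 a x + pd1 φ x * a x - h * pd2 b x - pd2 φ x * b x) ^ 2
    + (h * pd1 b x + pd1 φ x * b x + h * pd2 a x + pd2 φ x * a x) ^ 2

lemma integrable_crDensity {φ a b : ℝ × ℝ → ℝ} (hφ : ContDiff ℝ 1 φ) (ha : ContDiff ℝ 1 a)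
    (hb : ContDiff ℝ 1 b) (hsa : HasCompactSupport a) (hsb : HasCompactSupport b) (h : ℝ) :
    Integrable (crDensity h φ a b) := by
  have ca := ha.continuous
  have cb := hb.continuous
  have c1 := continuous_pd1 ha
  have c2 := continuous_pd2 ha
  have c3 := continuous_pd1 hb
  have c4 := continuous_pd2 hb
  have c5 := continuous_pd1 hφ
  have c6 := continuous_pd2 hφ
  refine integrable_of_eq_zero_off_compact (hsa.isCompact.union hsb.isCompact)
    (by unfold crDensity; fun_prop) fun x hx => ?_
  have h1 : x ∉ tsupport a := fun h => hx (Or.inl h)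
  have h2 : x ∉ tsupport b := fun h => hx (Or.inr h)
  simp [crDensity, image_eq_zero_of_notMem_tsupport h1, image_eq_zero_of_notMem_tsupport h2,
      pd1_eq_zero_of_notMem_tsupport h1, pd1_eq_zero_of_notMem_tsupport h2,
      pd2_eq_zero_of_notMem_tsupport h1, pd2_eq_zero_of_notMem_tsupport h2]

/-- The spin-down Pauli form is the squared norm of a weighted Cauchy–Riemann operator. -/
lemma integral_pauli_eq_integral_cauchyRiemann {φ a b : ℝ × ℝ → ℝ} (hφ : ContDiff ℝ 2 φ)
    (ha : ContDiff ℝ 2 a) (hb : ContDiff ℝ 2 b) (hsa : HasCompactSupport a)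
    (hsb : HasCompactSupport b) (h : ℝ) :
    ∫ x, ((h * pd1 a x - pd2 φ x * b x) ^ 2 + (h * pd1 b x + pd2 φ x * a x) ^ 2
        + ((h * pd2 a x + pd1 φ x * b x) ^ 2 + (h * pd2 b x - pd1 φ x * a x) ^ 2)
        - h * lap φ x * (a x ^ 2 + b x ^ 2)) =
      ∫ x, crDensity h φ a b x := by
  have ca := ha.continuous
  have cb := hb.continuous
  have da : Differentiable ℝ a := ha.differentiable (by norm_num)
  have db : Differentiable ℝ b := hb.differentiable (by norm_num)
  have ha1 := ha.of_le (m := 1) (by norm_num)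
  have hb1 := hb.of_le (m := 1) (by norm_num)
  have hp1 := contDiff_pd1 hφ
  have hp2 := contDiff_pd2 hφ
  have ha' := contDiff_pd1 ha
  have ha'' := contDiff_pd2 ha
  have hb' := contDiff_pd1 hb
  have hb'' := contDiff_pd2 hb
  have K : IsCompact (tsupport a ∪ tsupport b) := hsa.isCompact.union hsb.isCompact
  have z : ∀ x, x ∉ tsupport a ∪ tsupport b → a x = 0 ∧ b x = 0 ∧ pd1 a x = 0 ∧ pd1 b x = 0 ∧
      pd2 a x = 0 ∧ pd2 b x = 0 := fun x hx => by
    have h1 : x ∉ tsupport a := fun h => hx (Or.inl h)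
    have h2 : x ∉ tsupport b := fun h => hx (Or.inr h)
    exact ⟨image_eq_zero_of_notMem_tsupport h1, image_eq_zero_of_notMem_tsupport h2,
      pd1_eq_zero_of_notMem_tsupport h1, pd1_eq_zero_of_notMem_tsupport h2,
      pd2_eq_zero_of_notMem_tsupport h1, pd2_eq_zero_of_notMem_tsupport h2⟩
  set F : ℝ × ℝ → ℝ := fun x => h ^ 2 * (a x * pd2 b x - b x * pd2 a x)
    - h * (pd1 φ x * (a x * a x + b x * b x)) with hF
  set G : ℝ × ℝ → ℝ := fun x => h ^ 2 * (b x * pd1 a x - a x * pd1 b x)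
    - h * (pd2 φ x * (a x * a x + b x * b x)) with hG
  have cF : ContDiff ℝ 1 F := by fun_prop
  have cG : ContDiff ℝ 1 G := by fun_prop
  have sF : HasCompactSupport F := HasCompactSupport.intro K fun x hx => by
    simp [hF, z x hx]
  have sG : HasCompactSupport G := HasCompactSupport.intro K fun x hx => by
    simp [hG, z x hx]
  have dp1 : Differentiable ℝ (pd1 φ) := hp1.differentiable (by norm_num)
  have dp2 : Differentiable ℝ (pd2 φ) := hp2.differentiable (by norm_num)
  have da' : Differentiable ℝ (pd1 a) := ha'.differentiable (by norm_num)
  have da'' : Differentiable ℝ (pd2 a) := ha''.differentiable (by norm_num)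
  have db' : Differentiable ℝ (pd1 b) := hb'.differentiable (by norm_num)
  have db'' : Differentiable ℝ (pd2 b) := hb''.differentiable (by norm_num)
  have eF : ∀ x, pd1 F x = h ^ 2 * (a x * pd1 (pd2 b) x + pd1 a x * pd2 b x
      - (b x * pd1 (pd2 a) x + pd1 b x * pd2 a x))
      - h * (pd1 φ x * (a x * pd1 a x + pd1 a x * a x + (b x * pd1 b x + pd1 b x * b x))
        + pd1 (pd1 φ) x * (a x * a x + b x * b x)) := fun x => by
    rw [hF, pd1_sub (by fun_prop) (by fun_prop), pd1_const_mul _ (by fun_prop),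
      pd1_const_mul _ (by fun_prop), pd1_sub (by fun_prop) (by fun_prop),
      pd1_mul (da x) (db'' x), pd1_mul (db x) (da'' x), pd1_mul (dp1 x) (by fun_prop),
      pd1_add (by fun_prop) (by fun_prop), pd1_mul (da x) (da x), pd1_mul (db x) (db x)]
  have eG : ∀ x, pd2 G x = h ^ 2 * (b x * pd2 (pd1 a) x + pd2 b x * pd1 a x
      - (a x * pd2 (pd1 b) x + pd2 a x * pd1 b x))
      - h * (pd2 φ x * (a x * pd2 a x + pd2 a x * a x + (b x * pd2 b x + pd2 b x * b x))
        + pd2 (pd2 φ) x * (a x * a x + b x * b x)) := fun x => by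
    rw [hG, pd2_sub (by fun_prop) (by fun_prop), pd2_const_mul _ (by fun_prop),
      pd2_const_mul _ (by fun_prop), pd2_sub (by fun_prop) (by fun_prop),
      pd2_mul (db x) (da' x), pd2_mul (da x) (db' x), pd2_mul (dp2 x) (by fun_prop),
      pd2_add (by fun_prop) (by fun_prop), pd2_mul (da x) (da x), pd2_mul (db x) (db x)]
  rw [← integral_add_divergence (integrable_crDensity (hφ.of_le (by norm_num)) ha1 hb1 hsa hsb h)
    cF cG sF sG]
  congr 1; funext x
  rw [eF, eG, pd1_pd2_comm ha.contDiffAt, pd1_pd2_comm hb.contDiffAt, lap, crDensity]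
  ring

/-- Poincaré's inequality on a strip. -/
lemma integral_sq_le_integral_pd1_sq {a : ℝ × ℝ → ℝ} (ha : ContDiff ℝ 1 a)
    (hs : HasCompactSupport a) {R : ℝ} (hR : ∀ x ∈ tsupport a, |x.1| ≤ R) :
    ∫ x, a x ^ 2 ≤ 4 * R ^ 2 * ∫ x, pd1 a x ^ 2 := by
  have ca := ha.continuous
  have c1 := continuous_pd1 ha
  have da : Differentiable ℝ a := ha.differentiable (by norm_num)
  set F : ℝ × ℝ → ℝ := fun x => x.1 * (a x * a x)
  have cF : ContDiff ℝ 1 F := by fun_prop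
  have sF : HasCompactSupport F := HasCompactSupport.intro hs fun x hx => by
    simp [F, image_eq_zero_of_notMem_tsupport hx]
  have eF : ∀ x, pd1 F x = x.1 * (a x * pd1 a x + pd1 a x * a x) + a x * a x := fun x => by
    simp only [F]
    rw [pd1_mul (by fun_prop) (by fun_prop), pd1_mul (da x) (da x), pd1_fst, one_mul]
  have iF := integrable_of_eq_zero_off_compact sF (continuous_pd1 cF)
    fun x hx => pd1_eq_zero_of_notMem_tsupport hx
  have i0 : Integrable fun x => a x ^ 2 := integrable_of_eq_zero_off_compact hs (by fun_prop)
    fun x hx => by simp [image_eq_zero_of_notMem_tsupport hx]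
  have i1 : Integrable fun x => pd1 a x ^ 2 := integrable_of_eq_zero_off_compact hs (by fun_prop)
    fun x hx => by simp [pd1_eq_zero_of_notMem_tsupport hx]
  have key : ∫ x, a x ^ 2 ≤ ∫ x, (4 * R ^ 2 * pd1 a x ^ 2 + 2 * pd1 F x) := by
    refine integral_mono i0 ((i1.const_mul _).add (iF.const_mul _)) fun x => ?_
    by_cases hx : x ∈ tsupport a
    · have h1 : x.1 ^ 2 ≤ R ^ 2 := sq_le_sq.2 ((hR x hx).trans (le_abs_self R))
      simp only [eF]
      nlinarith [sq_nonneg (a x + 2 * x.1 * pd1 a x),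
        mul_le_mul_of_nonneg_right h1 (sq_nonneg (pd1 a x))]
    · simp [image_eq_zero_of_notMem_tsupport hx, eF]
      positivity
  rwa [integral_add (i1.const_mul _) (iF.const_mul _), integral_const_mul, integral_const_mul,
    integral_pd1_eq_zero cF sF, mul_zero, add_zero] at key

end Energy

section Disc

lemma isOpen_disc (R : ℝ) : IsOpen (disc R) :=
  isOpen_lt (by fun_prop) continuous_const

lemma closure_disc {R : ℝ} (hR : 0 < R) : closure (disc R) = {y | y.1 ^ 2 + y.2 ^ 2 ≤ R ^ 2} := by
  apply Subset.antisymm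
  · exact closure_minimal (fun x hx => le_of_lt (show x.1 ^ 2 + x.2 ^ 2 < R ^ 2 from hx)) (isClosed_le (by fun_prop) continuous_const)
  · intro x (hx : x.1 ^ 2 + x.2 ^ 2 ≤ R ^ 2)
    have ht : Tendsto (fun t : ℝ => t • x) (𝓝[<] 1) (𝓝 x) := by
      have : Continuous fun t : ℝ => t • x := by fun_prop
      simpa using (this.tendsto 1).mono_left nhdsWithin_le_nhds
    refine mem_closure_of_tendsto ht ?_
    filter_upwards [Ioo_mem_nhdsLT (show (0 : ℝ) < 1 by norm_num)] with t ht
    have h1 : t ^ 2 < 1 := by nlinarith [ht.1, ht.2]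
    change (t * x.1) ^ 2 + (t * x.2) ^ 2 < R ^ 2
    have : t ^ 2 * (x.1 ^ 2 + x.2 ^ 2) ≤ t ^ 2 * R ^ 2 :=
      mul_le_mul_of_nonneg_left hx (sq_nonneg t)
    nlinarith [pow_pos hR 2]

lemma frontier_disc {R : ℝ} (hR : 0 < R) : frontier (disc R) = {y | y.1 ^ 2 + y.2 ^ 2 = R ^ 2} := by
  rw [(isOpen_disc R).frontier_eq, closure_disc hR]
  ext x
  refine ⟨fun h => ?_, fun h => ?_⟩
  · exact le_antisymm h.1 (not_lt.1 h.2)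
  · exact ⟨le_of_eq h, not_lt.2 (ge_of_eq h)⟩

lemma isCompact_normSq_le (t : ℝ) : IsCompact {y : ℝ × ℝ | y.1 ^ 2 + y.2 ^ 2 ≤ t} := by
  refine Metric.isCompact_of_isClosed_isBounded (isClosed_le (by fun_prop) continuous_const) ?_
  refine (Metric.isBounded_closedBall (x := (0 : ℝ × ℝ)) (r := |t| + 1)).subset fun y hy => ?_
  have hy' : y.1 ^ 2 + y.2 ^ 2 ≤ |t| := le_trans hy (le_abs_self t)
  have h0 := abs_nonneg t
  rw [mem_closedBall_zero_iff, Prod.norm_def, max_le_iff, Real.norm_eq_abs, Real.norm_eq_abs]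
  constructor <;> apply abs_le_of_sq_le_sq _ (by positivity) <;>
    nlinarith [sq_nonneg y.1, sq_nonneg y.2]

lemma abs_fst_le_of_mem_disc {R : ℝ} (hR : 0 < R) {x : ℝ × ℝ} (hx : x ∈ disc R) : |x.1| ≤ R := by
  have hx' : x.1 ^ 2 + x.2 ^ 2 < R ^ 2 := hx
  exact abs_le_of_sq_le_sq (by nlinarith [sq_nonneg x.2]) hR.le

lemma exists_normSq_lt_of_compact {R : ℝ} (hR : 0 < R) {K : Set (ℝ × ℝ)} (hK : IsCompact K)
    (hKR : K ⊆ disc R) : ∃ s < R ^ 2, ∀ x ∈ K, x.1 ^ 2 + x.2 ^ 2 < s := by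
  rcases K.eq_empty_or_nonempty with rfl | hne
  · exact ⟨0, by positivity, by simp⟩
  obtain ⟨z, hz, hmax⟩ := hK.exists_isMaxOn hne
    (f := fun x : ℝ × ℝ => x.1 ^ 2 + x.2 ^ 2) (by fun_prop)
  obtain ⟨s, h1, h2⟩ := exists_between (show z.1 ^ 2 + z.2 ^ 2 < R ^ 2 from hKR hz)
  exact ⟨s, h2, fun x hx => lt_of_le_of_lt (hmax hx) h1⟩

/-- A radial cutoff, equal to `1` where `|x|² ≤ s` and to `0` where `|x|² ≥ t`. -/
noncomputable def radialCutoff (s t : ℝ) (x : ℝ × ℝ) : ℝ :=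
  Real.smoothTransition ((t - (x.1 ^ 2 + x.2 ^ 2)) / (t - s))

lemma contDiff_radialCutoff (s t : ℝ) {n : ℕ∞} : ContDiff ℝ n (radialCutoff s t) := by
  unfold radialCutoff
  exact Real.smoothTransition.contDiff.comp (by fun_prop)

lemma radialCutoff_eq_one {s t : ℝ} (hst : s < t) {x : ℝ × ℝ} (hx : x.1 ^ 2 + x.2 ^ 2 ≤ s) :
    radialCutoff s t x = 1 :=
  Real.smoothTransition.one_of_one_le (by rw [one_le_div (by linarith)]; linarith)

lemma radialCutoff_eq_zero {s t : ℝ} (hst : s < t) {x : ℝ × ℝ} (hx : t ≤ x.1 ^ 2 + x.2 ^ 2) :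
    radialCutoff s t x = 0 :=
  Real.smoothTransition.zero_of_nonpos (div_nonpos_of_nonpos_of_nonneg (by linarith) (by linarith))

lemma tsupport_radialCutoff_subset {s t : ℝ} (hst : s < t) :
    tsupport (radialCutoff s t) ⊆ {y | y.1 ^ 2 + y.2 ^ 2 ≤ t} := by
  refine closure_minimal (fun x hx => ?_) (isClosed_le (by fun_prop) continuous_const)
  by_contra h
  exact hx (radialCutoff_eq_zero hst (not_le.1 h).le)

lemma radialCutoff_eventuallyEq_one {s t : ℝ} (hst : s < t) {x : ℝ × ℝ}
    (hx : x.1 ^ 2 + x.2 ^ 2 < s) : radialCutoff s t =ᶠ[𝓝 x] fun _ => 1 := by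
  have : {y : ℝ × ℝ | y.1 ^ 2 + y.2 ^ 2 < s} ∈ 𝓝 x :=
    (isOpen_lt (by fun_prop) continuous_const).mem_nhds hx
  filter_upwards [this] with y hy using radialCutoff_eq_one hst (le_of_lt hy)

lemma exists_compactSupport_eventuallyEq {R : ℝ} (hR : 0 < R) {ψ : ℝ × ℝ → ℝ}
    (hψ : ContDiffOn ℝ 2 ψ (disc R)) {K : Set (ℝ × ℝ)} (hK : IsCompact K) (hKR : K ⊆ disc R) :
    ∃ φ, ContDiff ℝ 2 φ ∧ HasCompactSupport φ ∧ ∀ x ∈ K, φ =ᶠ[𝓝 x] ψ := by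
  obtain ⟨s, hs, hKs⟩ := exists_normSq_lt_of_compact hR hK hKR
  obtain ⟨t, hst, htR⟩ := exists_between hs
  refine ⟨fun x => radialCutoff s t x * ψ x, contDiff_iff_contDiffAt.2 fun x => ?_,
    HasCompactSupport.intro (isCompact_normSq_le t) fun x hx => ?_, fun x hx => ?_⟩
  · by_cases hx : x ∈ disc R
    · exact (contDiff_radialCutoff s t (n := 2)).contDiffAt.mul
        (hψ.contDiffAt ((isOpen_disc R).mem_nhds hx))
    · have hx' : t < x.1 ^ 2 + x.2 ^ 2 := lt_of_lt_of_le htR (not_lt.1 hx)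
      have : {y : ℝ × ℝ | t < y.1 ^ 2 + y.2 ^ 2} ∈ 𝓝 x :=
        (isOpen_lt continuous_const (by fun_prop)).mem_nhds hx'
      refine (contDiffAt_const (c := (0 : ℝ))).congr_of_eventuallyEq ?_
      filter_upwards [this] with y hy
      rw [radialCutoff_eq_zero hst (le_of_lt hy), zero_mul]
  · simp only [mem_ofPred_eq, not_le] at hx
    rw [radialCutoff_eq_zero hst hx.le, zero_mul]
  · filter_upwards [radialCutoff_eventuallyEq_one hst (hKs x hx)] with y hy
    rw [hy, one_mul]

end Disc

section Approximation

/-- A compactly supported `C¹` function is a limit in `C¹` of smooth functions. -/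
lemma exists_contDiff_near {φ : ℝ × ℝ → ℝ} (hφ : ContDiff ℝ 1 φ) (hs : HasCompactSupport φ)
    {ε : ℝ} (hε : 0 < ε) :
    ∃ w : ℝ × ℝ → ℝ, ContDiff ℝ (⊤ : ℕ∞) w ∧ ∀ x, |w x - φ x| ≤ ε ∧ |pd1 w x - pd1 φ x| ≤ ε ∧
      |pd2 w x - pd2 φ x| ≤ ε := by
  have hc' : Continuous (fderiv ℝ φ) := hφ.continuous_fderiv (by norm_num)
  have u0 := hs.uniformContinuous_of_continuous hφ.continuous
  have u1 := (hs.fderiv ℝ).uniformContinuous_of_continuous hc'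
  obtain ⟨δ₀, hδ₀, H0⟩ := Metric.uniformContinuous_iff.1 u0 ε hε
  obtain ⟨δ₁, hδ₁, H1⟩ := Metric.uniformContinuous_iff.1 u1 ε hε
  have hδ : 0 < min δ₀ δ₁ := lt_min hδ₀ hδ₁
  let ρ : ContDiffBump (0 : ℝ × ℝ) := ⟨min δ₀ δ₁ / 2, min δ₀ δ₁, half_pos hδ, half_lt_self hδ⟩
  have hli : LocallyIntegrable φ (volume : Measure (ℝ × ℝ)) := hφ.continuous.locallyIntegrable
  have hρ : LocallyIntegrable (ρ.normed volume) (volume : Measure (ℝ × ℝ)) :=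
    ρ.continuous_normed.locallyIntegrable
  set w := convolution (ρ.normed volume) φ (ContinuousLinearMap.lsmul ℝ ℝ) volume with hw
  have hd : ∀ x, fderiv ℝ w x = convolution (ρ.normed volume) (fderiv ℝ φ)
      (ContinuousLinearMap.lsmul ℝ ℝ) volume x := fun x => by
    rw [(hs.hasFDerivAt_convolution_right (ContinuousLinearMap.lsmul ℝ ℝ) hρ hφ x).fderiv]
    rfl
  have hd1 : ∀ x, ‖fderiv ℝ w x - fderiv ℝ φ x‖ ≤ ε := fun x => by
    rw [hd, ← dist_eq_norm]
    refine ρ.dist_normed_convolution_le hc'.aestronglyMeasurable fun y hy => ?_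
    exact (H1 (lt_of_lt_of_le hy (min_le_right _ _))).le
  have hn : ∀ x, ∀ v : ℝ × ℝ, ‖v‖ = 1 → |fderiv ℝ w x v - fderiv ℝ φ x v| ≤ ε := fun x v hv => by
    have := (fderiv ℝ w x - fderiv ℝ φ x).le_opNorm v
    rw [hv, mul_one] at this
    exact this.trans (hd1 x)
  refine ⟨w, ρ.hasCompactSupport_normed.contDiff_convolution_left _ ρ.contDiff_normed hli,
    fun x => ⟨?_, hn x _ (by simp [Prod.norm_def]), hn x _ (by simp [Prod.norm_def])⟩⟩
  rw [← Real.dist_eq]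
  refine ρ.dist_normed_convolution_le hφ.continuous.aestronglyMeasurable fun y hy => ?_
  exact (H0 (lt_of_lt_of_le hy (min_le_left _ _))).le

end Approximation

section PauliForm

variable {Ω : Set (ℝ × ℝ)} {u : ℝ × ℝ → ℂ} {x : ℝ × ℝ}

lemma pd1_re (hu : DifferentiableAt ℝ u x) : pd1 (fun y => (u y).re) x = (pd1 u x).re := by
  unfold pd1
  rw [show (fun y => (u y).re) = Complex.reCLM ∘ u from rfl,
    fderiv_comp x Complex.reCLM.differentiableAt hu]
  simp

lemma pd2_re (hu : DifferentiableAt ℝ u x) : pd2 (fun y => (u y).re) x = (pd2 u x).re := by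
  unfold pd2
  rw [show (fun y => (u y).re) = Complex.reCLM ∘ u from rfl,
    fderiv_comp x Complex.reCLM.differentiableAt hu]
  simp

lemma pd1_im (hu : DifferentiableAt ℝ u x) : pd1 (fun y => (u y).im) x = (pd1 u x).im := by
  unfold pd1
  rw [show (fun y => (u y).im) = Complex.imCLM ∘ u from rfl,
    fderiv_comp x Complex.imCLM.differentiableAt hu]
  simp

lemma pd2_im (hu : DifferentiableAt ℝ u x) : pd2 (fun y => (u y).im) x = (pd2 u x).im := by
  unfold pd2
  rw [show (fun y => (u y).im) = Complex.imCLM ∘ u from rfl,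
    fderiv_comp x Complex.imCLM.differentiableAt hu]
  simp

lemma IsTestFun.contDiff_re (hu : IsTestFun Ω u) {n : ℕ∞} : ContDiff ℝ n fun x => (u x).re :=
  Complex.reCLM.contDiff.comp (hu.1.of_le (by exact_mod_cast le_top))

lemma IsTestFun.contDiff_im (hu : IsTestFun Ω u) {n : ℕ∞} : ContDiff ℝ n fun x => (u x).im :=
  Complex.imCLM.contDiff.comp (hu.1.of_le (by exact_mod_cast le_top))

lemma tsupport_re_subset (u : ℝ × ℝ → ℂ) : tsupport (fun x => (u x).re) ⊆ tsupport u :=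
  closure_mono fun x hx h => hx (by simp [h])

lemma tsupport_im_subset (u : ℝ × ℝ → ℂ) : tsupport (fun x => (u x).im) ⊆ tsupport u :=
  closure_mono fun x hx h => hx (by simp [h])

lemma IsTestFun.hasCompactSupport_re (hu : IsTestFun Ω u) :
    HasCompactSupport fun x => (u x).re :=
  hu.2.1.of_isClosed_subset (isClosed_tsupport _) (tsupport_re_subset u)

lemma IsTestFun.hasCompactSupport_im (hu : IsTestFun Ω u) :
    HasCompactSupport fun x => (u x).im :=
  hu.2.1.of_isClosed_subset (isClosed_tsupport _) (tsupport_im_subset u)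

lemma sq_norm_eq_re_sq_add_im_sq (z : ℂ) : ‖z‖ ^ 2 = z.re ^ 2 + z.im ^ 2 := by
  rw [Complex.sq_norm, Complex.normSq_apply]; ring

lemma IsTestFun.integral_pos (hu : IsTestFun Ω u) :
    0 < ∫ x, ((u x).re ^ 2 + (u x).im ^ 2) := by
  have h1 := (hu.contDiff_re (n := 0)).continuous
  have h2 := (hu.contDiff_im (n := 0)).continuous
  obtain ⟨z, hz⟩ := Function.ne_iff.1 hu.2.2.2
  refine Continuous.integral_pos_of_hasCompactSupport_nonneg_nonzero (x := z) (by fun_prop) ?_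
    (fun x => by positivity) ?_
  · exact HasCompactSupport.intro hu.2.1 fun x hx => by
      simp [image_eq_zero_of_notMem_tsupport hx]
  · rw [← sq_norm_eq_re_sq_add_im_sq]
    exact pow_ne_zero 2 (norm_ne_zero_iff.2 hz)

lemma pauliRayleigh_down_eq {ψ φ B : ℝ × ℝ → ℝ} (hu : IsTestFun Ω u)
    (hB : ∀ x ∈ Ω, lap ψ x = B x) (hφ : ContDiff ℝ 2 φ) (hφψ : ∀ x ∈ tsupport u, φ =ᶠ[𝓝 x] ψ)
    (h : ℝ) :
    pauliRayleigh (-1) h (perpGrad ψ) B Ω u =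
      (∫ x, crDensity h φ (fun y => (u y).re) (fun y => (u y).im) x) /
        ∫ x, ((u x).re ^ 2 + (u x).im ^ 2) := by
  have hz : ∀ x, x ∉ Ω → u x = 0 ∧ pd1 u x = 0 ∧ pd2 u x = 0 := fun x hx => by
    have hx' : x ∉ tsupport u := fun h => hx (hu.2.2.1 h)
    exact ⟨image_eq_zero_of_notMem_tsupport hx', pd1_eq_zero_of_notMem_tsupport hx',
      pd2_eq_zero_of_notMem_tsupport hx'⟩
  have hd : Differentiable ℝ u := hu.1.differentiable (by norm_num)
  set a : ℝ × ℝ → ℝ := fun y => (u y).re with ha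
  set b : ℝ × ℝ → ℝ := fun y => (u y).im with hb
  have ca : ContDiff ℝ 2 a := hu.contDiff_re (n := 2)
  have cb : ContDiff ℝ 2 b := hu.contDiff_im (n := 2)
  unfold pauliRayleigh
  rw [setIntegral_eq_integral_of_forall_compl_eq_zero (fun x hx => by simp [hz x hx]),
    setIntegral_eq_integral_of_forall_compl_eq_zero (fun x hx => by simp [hz x hx]),
    setIntegral_eq_integral_of_forall_compl_eq_zero (fun x hx => by simp [hz x hx])]
  simp only [sq_norm_eq_re_sq_add_im_sq]
  rw [← integral_pauli_eq_integral_cauchyRiemann hφ ca cb hu.hasCompactSupport_re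
    hu.hasCompactSupport_im]
  congr 1
  have cr := ca.continuous
  have ci := cb.continuous
  have ca1 := ca.of_le (m := 1) (by norm_num)
  have cb1 := cb.of_le (m := 1) (by norm_num)
  have c1 := continuous_pd1 ca1
  have c2 := continuous_pd2 ca1
  have c3 := continuous_pd1 cb1
  have c4 := continuous_pd2 cb1
  have c5 := (contDiff_pd1 hφ).continuous
  have c6 := (contDiff_pd2 hφ).continuous
  have c7 : Continuous (lap φ) :=
    (continuous_pd1 (contDiff_pd1 hφ)).add (continuous_pd2 (contDiff_pd2 hφ))
  have z : ∀ x, x ∉ tsupport u → a x = 0 ∧ b x = 0 ∧ pd1 a x = 0 ∧ pd1 b x = 0 ∧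
      pd2 a x = 0 ∧ pd2 b x = 0 := fun x hx => by
    have h1 : x ∉ tsupport a := fun h => hx (tsupport_re_subset u h)
    have h2 : x ∉ tsupport b := fun h => hx (tsupport_im_subset u h)
    exact ⟨image_eq_zero_of_notMem_tsupport h1, image_eq_zero_of_notMem_tsupport h2,
      pd1_eq_zero_of_notMem_tsupport h1, pd1_eq_zero_of_notMem_tsupport h2,
      pd2_eq_zero_of_notMem_tsupport h1, pd2_eq_zero_of_notMem_tsupport h2⟩
  have e1 : ∀ x, ((h : ℂ) * pd1 u x - Complex.I * ((perpGrad ψ x).1 : ℂ) * u x).re ^ 2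
      + ((h : ℂ) * pd1 u x - Complex.I * ((perpGrad ψ x).1 : ℂ) * u x).im ^ 2
      + (((h : ℂ) * pd2 u x - Complex.I * ((perpGrad ψ x).2 : ℂ) * u x).re ^ 2
      + ((h : ℂ) * pd2 u x - Complex.I * ((perpGrad ψ x).2 : ℂ) * u x).im ^ 2)
      = (h * pd1 a x - pd2 φ x * b x) ^ 2 + (h * pd1 b x + pd2 φ x * a x) ^ 2
        + ((h * pd2 a x + pd1 φ x * b x) ^ 2 + (h * pd2 b x - pd1 φ x * a x) ^ 2) := fun x => by
    have e2 : pd1 a x = (pd1 u x).re := pd1_re (hd x)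
    have e3 : pd1 b x = (pd1 u x).im := pd1_im (hd x)
    have e4 : pd2 a x = (pd2 u x).re := pd2_re (hd x)
    have e5 : pd2 b x = (pd2 u x).im := pd2_im (hd x)
    by_cases hx : x ∈ tsupport u
    · rw [e2, e3, e4, e5, pd1_congr (hφψ x hx), pd2_congr (hφψ x hx)]
      simp [perpGrad, a, b]
      ring
    · have h0 : u x = 0 := image_eq_zero_of_notMem_tsupport hx
      have h1 : pd1 u x = 0 := pd1_eq_zero_of_notMem_tsupport hx
      have h2 : pd2 u x = 0 := pd2_eq_zero_of_notMem_tsupport hx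
      obtain ⟨z1, z2, z3, z4, z5, z6⟩ := z x hx
      simp [h0, h1, h2, z1, z2, z3, z4, z5, z6]
  have e2 : ∀ x, B x * ((u x).re ^ 2 + (u x).im ^ 2) = lap φ x * (a x ^ 2 + b x ^ 2) :=
    fun x => by
    by_cases hx : x ∈ tsupport u
    · rw [lap_congr (hφψ x hx), hB x (hu.2.2.1 hx)]
    · obtain ⟨z1, z2, -⟩ := z x hx
      simp only [a, b] at z1 z2
      simp [a, b, z1, z2]
  simp_rw [e1, e2]
  rw [neg_one_mul, ← sub_eq_add_neg, ← integral_const_mul, ← integral_sub]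
  · simp_rw [mul_assoc]
  · refine integrable_of_eq_zero_off_compact hu.2.1 (by fun_prop) fun x hx => ?_
    obtain ⟨z1, z2, z3, z4, z5, z6⟩ := z x hx
    simp [z1, z2, z3, z4, z5, z6]
  · refine integrable_of_eq_zero_off_compact hu.2.1 (by fun_prop) fun x hx => ?_
    obtain ⟨z1, z2, -⟩ := z x hx
    simp [z1, z2]

lemma pd1_conj (u : ℝ × ℝ → ℂ) (x : ℝ × ℝ) :
    pd1 (fun y => (starRingEnd ℂ) (u y)) x = (starRingEnd ℂ) (pd1 u x) := by
  unfold pd1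
  rw [show (fun y => (starRingEnd ℂ) (u y)) = Complex.conjCLE ∘ u from rfl,
    Complex.conjCLE.comp_fderiv]
  simp

lemma pd2_conj (u : ℝ × ℝ → ℂ) (x : ℝ × ℝ) :
    pd2 (fun y => (starRingEnd ℂ) (u y)) x = (starRingEnd ℂ) (pd2 u x) := by
  unfold pd2
  rw [show (fun y => (starRingEnd ℂ) (u y)) = Complex.conjCLE ∘ u from rfl,
    Complex.conjCLE.comp_fderiv]
  simp

lemma IsTestFun.conj (hu : IsTestFun Ω u) : IsTestFun Ω fun x => (starRingEnd ℂ) (u x) := by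
  have hs : Function.support (fun x => (starRingEnd ℂ) (u x)) = Function.support u := by
    ext x; simp
  refine ⟨Complex.conjCLE.contDiff.comp hu.1, ?_, ?_, fun h => hu.2.2.2 ?_⟩
  · unfold HasCompactSupport tsupport; rw [hs]; exact hu.2.1
  · unfold tsupport; rw [hs]; exact hu.2.2.1
  · funext x
    simpa using congrFun h x

lemma pauliRayleigh_conj (h : ℝ) (ψ B : ℝ × ℝ → ℝ) (u : ℝ × ℝ → ℂ) :
    pauliRayleigh (-1) h (perpGrad fun y => -ψ y) (fun y => -B y) Ω
      (fun y => (starRingEnd ℂ) (u y)) = pauliRayleigh 1 h (perpGrad ψ) B Ω u := by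
  unfold pauliRayleigh
  simp only [perpGrad, pd1_neg, pd2_neg, pd1_conj, pd2_conj, RCLike.norm_conj]
  have e1 : ∀ (z v : ℂ) (c : ℝ), ‖(h : ℂ) * (starRingEnd ℂ) z
      - Complex.I * ((-c : ℝ) : ℂ) * (starRingEnd ℂ) v‖ = ‖(h : ℂ) * z - Complex.I * (c : ℂ) * v‖ :=
    fun z v c => by
    rw [← Complex.norm_conj ((h : ℂ) * z - Complex.I * (c : ℂ) * v)]
    congr 1
    simp
  simp only [e1]
  congr 2
  simp only [neg_mul]
  rw [integral_neg]
  ring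

lemma lambdaPlusD_eq_lambdaMinusD_neg (h : ℝ) (ψ B : ℝ × ℝ → ℝ) :
    lambdaPlusD h (perpGrad ψ) B Ω =
      lambdaMinusD h (perpGrad fun y => -ψ y) (fun y => -B y) Ω := by
  unfold lambdaPlusD lambdaMinusD
  congr 1
  ext r
  constructor
  · rintro ⟨u, hu, rfl⟩
    exact ⟨_, hu.conj, pauliRayleigh_conj h ψ B u⟩
  · rintro ⟨u, hu, rfl⟩
    refine ⟨_, hu.conj, ?_⟩
    rw [← pauliRayleigh_conj]
    simp

end PauliForm

section Bounds

variable {R : ℝ} {ψ B : ℝ × ℝ → ℝ}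

lemma crDensity_exp_mul {φ a b : ℝ × ℝ → ℝ} {x : ℝ × ℝ} {h : ℝ} (hh : h ≠ 0)
    (hφ : DifferentiableAt ℝ φ x) (ha : DifferentiableAt ℝ a x) (hb : DifferentiableAt ℝ b x) :
    crDensity h (fun _ => 0) (fun y => Real.exp (h⁻¹ * φ y) * a y)
      (fun y => Real.exp (h⁻¹ * φ y) * b y) x =
      Real.exp (h⁻¹ * φ x) ^ 2 * crDensity h φ a b x := by
  have d : DifferentiableAt ℝ (fun y => h⁻¹ * φ y) x := by fun_prop
  have d' : DifferentiableAt ℝ (fun y => Real.exp (h⁻¹ * φ y)) x := by fun_prop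
  have z1 : pd1 (fun _ : ℝ × ℝ => (0 : ℝ)) x = 0 := by simp [pd1]
  have z2 : pd2 (fun _ : ℝ × ℝ => (0 : ℝ)) x = 0 := by simp [pd2]
  unfold crDensity
  rw [z1, z2, pd1_mul d' ha, pd1_mul d' hb, pd2_mul d' ha, pd2_mul d' hb, pd1_exp d, pd2_exp d,
    pd1_const_mul _ hφ, pd2_const_mul _ hφ]
  field_simp
  ring

lemma integral_crDensity_zero {a b : ℝ × ℝ → ℝ} (ha : ContDiff ℝ 2 a) (hb : ContDiff ℝ 2 b)
    (hsa : HasCompactSupport a) (hsb : HasCompactSupport b) (h : ℝ) :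
    ∫ x, crDensity h (fun _ => 0) a b x =
      h ^ 2 * ∫ x, (pd1 a x ^ 2 + pd1 b x ^ 2 + (pd2 a x ^ 2 + pd2 b x ^ 2)) := by
  rw [← integral_pauli_eq_integral_cauchyRiemann contDiff_const ha hb hsa hsb, ← integral_const_mul]
  congr 1; funext x
  have z1 : pd1 (fun _ : ℝ × ℝ => (0 : ℝ)) = fun _ => 0 := by funext y; simp [pd1]
  have z2 : pd2 (fun _ : ℝ × ℝ => (0 : ℝ)) = fun _ => 0 := by funext y; simp [pd2]
  have z3 : lap (fun _ : ℝ × ℝ => (0 : ℝ)) x = 0 := by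
    simp [lap, z1, z2, pd1, pd2]
  rw [z1, z2, z3]
  ring

lemma sq_mul_integral_le_integral_crDensity_zero {a b : ℝ × ℝ → ℝ} (ha : ContDiff ℝ 2 a)
    (hb : ContDiff ℝ 2 b) (hsa : HasCompactSupport a) (hsb : HasCompactSupport b) (hR : 0 < R)
    (hRa : ∀ x ∈ tsupport a, |x.1| ≤ R) (hRb : ∀ x ∈ tsupport b, |x.1| ≤ R) (h : ℝ) :
    h ^ 2 / (4 * R ^ 2) * ∫ x, (a x ^ 2 + b x ^ 2) ≤ ∫ x, crDensity h (fun _ => 0) a b x := by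
  have ha1 := ha.of_le (m := 1) (by norm_num)
  have hb1 := hb.of_le (m := 1) (by norm_num)
  have ca := ha.continuous
  have cb := hb.continuous
  have c1 := continuous_pd1 ha1
  have c2 := continuous_pd2 ha1
  have c3 := continuous_pd1 hb1
  have c4 := continuous_pd2 hb1
  have ia : Integrable fun x => a x ^ 2 := integrable_of_eq_zero_off_compact hsa (by fun_prop)
    fun x hx => by simp [image_eq_zero_of_notMem_tsupport hx]
  have ib : Integrable fun x => b x ^ 2 := integrable_of_eq_zero_off_compact hsb (by fun_prop)
    fun x hx => by simp [image_eq_zero_of_notMem_tsupport hx]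
  have ia1 : Integrable fun x => pd1 a x ^ 2 := integrable_of_eq_zero_off_compact hsa
    (by fun_prop) fun x hx => by simp [pd1_eq_zero_of_notMem_tsupport hx]
  have ib1 : Integrable fun x => pd1 b x ^ 2 := integrable_of_eq_zero_off_compact hsb
    (by fun_prop) fun x hx => by simp [pd1_eq_zero_of_notMem_tsupport hx]
  have ia2 : Integrable fun x => pd2 a x ^ 2 := integrable_of_eq_zero_off_compact hsa
    (by fun_prop) fun x hx => by simp [pd2_eq_zero_of_notMem_tsupport hx]
  have ib2 : Integrable fun x => pd2 b x ^ 2 := integrable_of_eq_zero_off_compact hsb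
    (by fun_prop) fun x hx => by simp [pd2_eq_zero_of_notMem_tsupport hx]
  have h1 : ∫ x, (pd1 a x ^ 2 + pd1 b x ^ 2) ≤
      ∫ x, (pd1 a x ^ 2 + pd1 b x ^ 2 + (pd2 a x ^ 2 + pd2 b x ^ 2)) :=
    integral_mono (ia1.add ib1) ((ia1.add ib1).add (ia2.add ib2))
      fun x => le_add_of_nonneg_right (by positivity)
  have h2 : ∫ x, (a x ^ 2 + b x ^ 2) ≤ 4 * R ^ 2 * ∫ x, (pd1 a x ^ 2 + pd1 b x ^ 2) := by
    rw [integral_add ia ib, integral_add ia1 ib1, mul_add]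
    exact add_le_add (integral_sq_le_integral_pd1_sq ha1 hsa hRa)
      (integral_sq_le_integral_pd1_sq hb1 hsb hRb)
  rw [integral_crDensity_zero ha hb hsa hsb]
  calc _ ≤ h ^ 2 / (4 * R ^ 2) * (4 * R ^ 2 * ∫ x, (pd1 a x ^ 2 + pd1 b x ^ 2)) := by gcongr
    _ = h ^ 2 * ∫ x, (pd1 a x ^ 2 + pd1 b x ^ 2) := by field_simp
    _ ≤ _ := by gcongr

lemma le_pauliRayleigh_down (hR : 0 < R) (hψ : ContDiffOn ℝ 2 ψ (disc R))
    (hB : ∀ x ∈ disc R, lap ψ x = B x) {m M : ℝ} (hm : ∀ x ∈ disc R, m ≤ ψ x)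
    (hM : ∀ x ∈ disc R, ψ x ≤ M) {h : ℝ} (hh : 0 < h) {u : ℝ × ℝ → ℂ}
    (hu : IsTestFun (disc R) u) :
    h ^ 2 / (4 * R ^ 2) * Real.exp (-(2 * (M - m) / h)) ≤
      pauliRayleigh (-1) h (perpGrad ψ) B (disc R) u := by
  obtain ⟨φ, hφ, -, hφψ⟩ := exists_compactSupport_eventuallyEq hR hψ hu.2.1.isCompact hu.2.2.1
  rw [pauliRayleigh_down_eq hu hB hφ hφψ, le_div_iff₀ hu.integral_pos]
  set a : ℝ × ℝ → ℝ := fun y => (u y).re with ha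
  set b : ℝ × ℝ → ℝ := fun y => (u y).im with hb
  have ca : ContDiff ℝ 2 a := hu.contDiff_re (n := 2)
  have cb : ContDiff ℝ 2 b := hu.contDiff_im (n := 2)
  have hsa : HasCompactSupport a := hu.hasCompactSupport_re
  have hsb : HasCompactSupport b := hu.hasCompactSupport_im
  have cφ := hφ.continuous
  have ca' := ca.continuous
  have cb' := cb.continuous
  set p : ℝ × ℝ → ℝ := fun y => Real.exp (h⁻¹ * φ y) * a y with hp
  set q : ℝ × ℝ → ℝ := fun y => Real.exp (h⁻¹ * φ y) * b y with hq
  have cp : ContDiff ℝ 2 p := by fun_prop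
  have cq : ContDiff ℝ 2 q := by fun_prop
  have hsp : HasCompactSupport p := hsa.mul_left
  have hsq : HasCompactSupport q := hsb.mul_left
  have tp : tsupport p ⊆ tsupport u :=
    (tsupport_mul_subset_right (f := fun y => Real.exp (h⁻¹ * φ y))).trans (tsupport_re_subset u)
  have tq : tsupport q ⊆ tsupport u :=
    (tsupport_mul_subset_right (f := fun y => Real.exp (h⁻¹ * φ y))).trans (tsupport_im_subset u)
  have key := sq_mul_integral_le_integral_crDensity_zero cp cq hsp hsq hR
    (fun x hx => abs_fst_le_of_mem_disc hR (hu.2.2.1 (tp hx)))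
    (fun x hx => abs_fst_le_of_mem_disc hR (hu.2.2.1 (tq hx))) h
  have hsq_exp : ∀ t : ℝ, Real.exp (h⁻¹ * t) ^ 2 = Real.exp (2 * t / h) := fun t => by
    rw [← Real.exp_nat_mul]; congr 1; push_cast; field_simp
  have hE : ∀ x, crDensity h (fun _ => 0) p q x =
      Real.exp (2 * φ x / h) * crDensity h φ a b x := fun x => by
    rw [← hsq_exp]
    exact crDensity_exp_mul hh.ne' (hφ.differentiable (by norm_num) x)
      (ca.differentiable (by norm_num) x) (cb.differentiable (by norm_num) x)
  have i1 := integrable_crDensity (hφ.of_le (m := 1) (by norm_num)) (ca.of_le (by norm_num))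
    (cb.of_le (by norm_num)) hsa hsb h
  have i2 := integrable_crDensity (contDiff_const (c := (0 : ℝ)) (n := 1))
    (cp.of_le (by norm_num)) (cq.of_le (by norm_num)) hsp hsq h
  have i3 : Integrable fun x => a x ^ 2 + b x ^ 2 :=
    integrable_of_eq_zero_off_compact hu.2.1 (by fun_prop) fun x hx => by
      simp [a, b, image_eq_zero_of_notMem_tsupport hx]
  have i4 : Integrable fun x => p x ^ 2 + q x ^ 2 :=
    integrable_of_eq_zero_off_compact hu.2.1 (by fun_prop) fun x hx => by
      simp [p, q, a, b, image_eq_zero_of_notMem_tsupport hx]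
  have up : ∫ x, crDensity h (fun _ => 0) p q x ≤
      Real.exp (2 * M / h) * ∫ x, crDensity h φ a b x := by
    rw [← integral_const_mul]
    refine integral_mono i2 (i1.const_mul _) fun x => ?_
    have hnn : 0 ≤ crDensity h φ a b x := by unfold crDensity; positivity
    simp only [hE]
    by_cases hx : x ∈ tsupport u
    · have := hM x (hu.2.2.1 hx)
      rw [(hφψ x hx).eq_of_nhds]
      gcongr
    · have h1 : x ∉ tsupport a := fun h => hx (tsupport_re_subset u h)
      have h2 : x ∉ tsupport b := fun h => hx (tsupport_im_subset u h)
      have : crDensity h φ a b x = 0 := by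
        simp [crDensity, image_eq_zero_of_notMem_tsupport h1, image_eq_zero_of_notMem_tsupport h2,
          pd1_eq_zero_of_notMem_tsupport h1, pd1_eq_zero_of_notMem_tsupport h2,
          pd2_eq_zero_of_notMem_tsupport h1, pd2_eq_zero_of_notMem_tsupport h2]
      simp [this]
  have low : Real.exp (2 * m / h) * ∫ x, (a x ^ 2 + b x ^ 2) ≤ ∫ x, (p x ^ 2 + q x ^ 2) := by
    rw [← integral_const_mul]
    refine integral_mono (i3.const_mul _) i4 fun x => ?_
    have e : p x ^ 2 + q x ^ 2 = Real.exp (2 * φ x / h) * (a x ^ 2 + b x ^ 2) := by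
      rw [← hsq_exp]; simp only [p, q]; ring
    simp only [e]
    by_cases hx : x ∈ tsupport u
    · have := hm x (hu.2.2.1 hx)
      rw [(hφψ x hx).eq_of_nhds]
      gcongr
    · simp [a, b, image_eq_zero_of_notMem_tsupport hx]
  have hexp : Real.exp (-(2 * (M - m) / h)) * Real.exp (2 * M / h) = Real.exp (2 * m / h) := by
    rw [← Real.exp_add]; congr 1; ring
  have hfin : h ^ 2 / (4 * R ^ 2) * (Real.exp (2 * m / h) * ∫ x, (a x ^ 2 + b x ^ 2)) ≤
      Real.exp (2 * M / h) * ∫ x, crDensity h φ a b x :=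
    le_trans (by gcongr) (key.trans up)
  refine le_of_mul_le_mul_left ?_ (Real.exp_pos (2 * M / h))
  refine le_trans (le_of_eq ?_) hfin
  rw [← hexp]; ring

lemma exists_isTestFun_disc (hR : 0 < R) : ∃ u, IsTestFun (disc R) u := by
  have h0 : (0 : ℝ) < R ^ 2 / 2 := by positivity
  have hc : ContDiff ℝ (⊤ : ℕ∞) (radialCutoff 0 (R ^ 2 / 2)) := contDiff_radialCutoff _ _
  have ht := tsupport_radialCutoff_subset h0
  have hs : tsupport (fun x => (radialCutoff 0 (R ^ 2 / 2) x : ℂ)) ⊆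
      tsupport (radialCutoff 0 (R ^ 2 / 2)) := closure_mono fun x hx h => hx (by simp [h])
  refine ⟨fun x => (radialCutoff 0 (R ^ 2 / 2) x : ℂ), Complex.ofRealCLM.contDiff.comp hc,
    (isCompact_normSq_le _).of_isClosed_subset (isClosed_tsupport _) (hs.trans ht), ?_, fun h => ?_⟩
  · exact fun x hx => show x.1 ^ 2 + x.2 ^ 2 < R ^ 2 from
      lt_of_le_of_lt (show x.1 ^ 2 + x.2 ^ 2 ≤ R ^ 2 / 2 from ht (hs hx)) (by linarith)
  · have := congrFun h 0
    simp [radialCutoff_eq_one h0] at this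

/-- The spin-down Dirichlet ground state energy is bounded below by
`h² / (4R²) · exp(-2 (M - m) / h)` if `m ≤ ψ ≤ M`. -/
lemma le_lambdaMinusD (hR : 0 < R) (hψ : ContDiffOn ℝ 2 ψ (disc R))
    (hB : ∀ x ∈ disc R, lap ψ x = B x) {m M : ℝ} (hm : ∀ x ∈ disc R, m ≤ ψ x)
    (hM : ∀ x ∈ disc R, ψ x ≤ M) {h : ℝ} (hh : 0 < h) :
    h ^ 2 / (4 * R ^ 2) * Real.exp (-(2 * (M - m) / h)) ≤
      lambdaMinusD h (perpGrad ψ) B (disc R) := by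
  refine le_csInf ?_ ?_
  · obtain ⟨u, hu⟩ := exists_isTestFun_disc hR
    exact ⟨_, u, hu, rfl⟩
  · rintro _ ⟨u, hu, rfl⟩
    exact le_pauliRayleigh_down hR hψ hB hm hM hh hu

end Bounds

section UpperBound

variable {R : ℝ} {ψ B χ : ℝ × ℝ → ℝ}

lemma crDensity_exp_mul_le {φ v : ℝ × ℝ → ℝ} {x : ℝ × ℝ} {h ε : ℝ} (hh : h ≠ 0)
    (hv : DifferentiableAt ℝ v x) (hχ : DifferentiableAt ℝ χ x)
    (h1 : |pd1 v x - pd1 φ x| ≤ ε) (h2 : |pd2 v x - pd2 φ x| ≤ ε) :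
    crDensity h φ (fun y => Real.exp (-h⁻¹ * v y) * χ y) (fun _ => 0) x ≤
      2 * h ^ 2 * (Real.exp (-h⁻¹ * v x) ^ 2 * (pd1 χ x ^ 2 + pd2 χ x ^ 2)) +
        4 * ε ^ 2 * (Real.exp (-h⁻¹ * v x) * χ x) ^ 2 := by
  have d : DifferentiableAt ℝ (fun y => -h⁻¹ * v y) x := by fun_prop
  have d' : DifferentiableAt ℝ (fun y => Real.exp (-h⁻¹ * v y)) x := by fun_prop
  have z1 : pd1 (fun _ : ℝ × ℝ => (0 : ℝ)) x = 0 := by simp [pd1]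
  have z2 : pd2 (fun _ : ℝ × ℝ => (0 : ℝ)) x = 0 := by simp [pd2]
  have e1 : (pd1 v x - pd1 φ x) ^ 2 ≤ ε ^ 2 := sq_le_sq' (abs_le.1 h1).1 (abs_le.1 h1).2
  have e2 : (pd2 v x - pd2 φ x) ^ 2 ≤ ε ^ 2 := sq_le_sq' (abs_le.1 h2).1 (abs_le.1 h2).2
  unfold crDensity
  rw [z1, z2, pd1_mul d' hχ, pd2_mul d' hχ, pd1_exp d, pd2_exp d, pd1_const_mul _ hv,
    pd2_const_mul _ hv]
  set E := Real.exp (-h⁻¹ * v x)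
  have r1 : h * (E * pd1 χ x + E * (-h⁻¹ * pd1 v x) * χ x) + pd1 φ x * (E * χ x) - h * 0
      - pd2 φ x * 0 = E * (h * pd1 χ x) - E * χ x * (pd1 v x - pd1 φ x) := by
    field_simp; ring
  have r2 : h * 0 + pd1 φ x * 0 + h * (E * pd2 χ x + E * (-h⁻¹ * pd2 v x) * χ x)
      + pd2 φ x * (E * χ x) = E * (h * pd2 χ x) - E * χ x * (pd2 v x - pd2 φ x) := by
    field_simp; ring
  have key : ∀ s t : ℝ, (s - t) ^ 2 ≤ 2 * s ^ 2 + 2 * t ^ 2 := fun s t => by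
    nlinarith [sq_nonneg (s + t)]
  rw [r1, r2]
  have f1 := mul_le_mul_of_nonneg_left e1 (sq_nonneg (E * χ x))
  have f2 := mul_le_mul_of_nonneg_left e2 (sq_nonneg (E * χ x))
  refine (add_le_add (key _ _) (key _ _)).trans ?_
  linarith

/-- A cut-off quasi-mode bounds the spin-down ground state energy from above. -/
lemma exists_lambdaMinusD_le (hR : 0 < R) (hψ : ContDiffOn ℝ 2 ψ (disc R))
    (hB : ∀ x ∈ disc R, lap ψ x = B x) {m M : ℝ} (hm : ∀ x ∈ disc R, m ≤ ψ x)
    (hM : ∀ x ∈ disc R, ψ x ≤ M) (hχ : ContDiff ℝ (⊤ : ℕ∞) χ) (hcs : HasCompactSupport χ)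
    (hχR : tsupport χ ⊆ disc R) {μ ν : ℝ}
    (hν : ∀ x ∈ disc R, pd1 χ x ≠ 0 ∨ pd2 χ x ≠ 0 → ν ≤ ψ x) {U : Set (ℝ × ℝ)} (hU : IsOpen U)
    (hne : U.Nonempty) (hU1 : ∀ x ∈ U, χ x = 1) (hμ : ∀ x ∈ U, ψ x ≤ μ) {ε : ℝ} (hε : 0 < ε) :
    ∃ C > 0, ∀ h > 0, lambdaMinusD h (perpGrad ψ) B (disc R) ≤
      C * h ^ 2 * Real.exp (-(2 * (ν - μ - 2 * ε) / h)) := by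
  have hUs : U ⊆ tsupport χ := fun x hx => subset_tsupport _ (by simp [hU1 x hx])
  have hUfin : volume U < ⊤ := (measure_mono hUs).trans_lt hcs.measure_lt_top
  set V := volume.real U with hV
  have hVpos : 0 < V := ENNReal.toReal_pos (hU.measure_pos _ hne).ne' hUfin.ne
  set D := ∫ x, (pd1 χ x ^ 2 + pd2 χ x ^ 2) with hD
  have hD0 : 0 ≤ D := integral_nonneg fun x => by positivity
  obtain ⟨φ, hφ, hφs, hφψ⟩ := exists_compactSupport_eventuallyEq hR hψ hcs.isCompact hχR
  refine ⟨2 * D / V + 4, by positivity, fun h hh => ?_⟩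
  obtain ⟨v, hv, hvφ⟩ := exists_contDiff_near (hφ.of_le (m := 1) (by norm_num)) hφs
    (lt_min hε (mul_pos hh (Real.exp_pos (-((ν - μ) / h)))))
  set δ := min ε (h * Real.exp (-((ν - μ) / h))) with hδ
  have hδ0 : 0 ≤ δ := (lt_min hε (mul_pos hh (Real.exp_pos _))).le
  set a : ℝ × ℝ → ℝ := fun y => Real.exp (-h⁻¹ * v y) * χ y with ha
  have ca : ContDiff ℝ (⊤ : ℕ∞) a := by fun_prop
  have hsa : HasCompactSupport a := hcs.mul_left
  have ta : tsupport (fun x => (a x : ℂ)) ⊆ tsupport χ :=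
    closure_mono fun x hx h => hx (by simp [a, h])
  have hu : IsTestFun (disc R) fun x => (a x : ℂ) := by
    refine ⟨Complex.ofRealCLM.contDiff.comp ca, hcs.isCompact.of_isClosed_subset
      (isClosed_tsupport _) ta, ta.trans hχR, fun h => ?_⟩
    obtain ⟨x, hx⟩ := hne
    have := congrFun h x
    simp [a, hU1 x hx] at this
  have hle : lambdaMinusD h (perpGrad ψ) B (disc R) ≤
      pauliRayleigh (-1) h (perpGrad ψ) B (disc R) fun x => (a x : ℂ) := by
    refine csInf_le ⟨h ^ 2 / (4 * R ^ 2) * Real.exp (-(2 * (M - m) / h)), ?_⟩ ⟨_, hu, rfl⟩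
    rintro _ ⟨u, hu, rfl⟩
    exact le_pauliRayleigh_down hR hψ hB hm hM hh hu
  have hN := hu.integral_pos
  refine hle.trans ?_
  rw [pauliRayleigh_down_eq hu hB hφ (fun x hx => hφψ x (ta hx)), div_le_iff₀ hN]
  simp only [Complex.ofReal_re, Complex.ofReal_im] at hN ⊢
  have hsq_exp : ∀ t : ℝ, Real.exp (-h⁻¹ * t) ^ 2 = Real.exp (-(2 * t / h)) := fun t => by
    rw [← Real.exp_nat_mul]; congr 1; push_cast; field_simp
  have χ1 := hχ.of_le (m := 1) (by norm_cast)
  have c1 := continuous_pd1 χ1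
  have c2 := continuous_pd2 χ1
  have iD : Integrable fun x => pd1 χ x ^ 2 + pd2 χ x ^ 2 :=
    integrable_of_eq_zero_off_compact hcs (by fun_prop) fun x hx => by
      simp [pd1_eq_zero_of_notMem_tsupport hx, pd2_eq_zero_of_notMem_tsupport hx]
  have iN : Integrable fun x => a x ^ 2 + 0 ^ 2 :=
    integrable_of_eq_zero_off_compact hsa (by have := ca.continuous; fun_prop) fun x hx => by
      simp [image_eq_zero_of_notMem_tsupport hx]
  set N := ∫ x, (a x ^ 2 + 0 ^ 2) with hNdef
  have hup : ∫ x, crDensity h φ a (fun _ => 0) x ≤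
      2 * h ^ 2 * Real.exp (-(2 * (ν - ε) / h)) * D + 4 * δ ^ 2 * N := by
    rw [hD, hNdef, ← integral_const_mul, ← integral_const_mul,
      ← integral_add (iD.const_mul _) (iN.const_mul _)]
    refine integral_mono (integrable_crDensity (hφ.of_le (by norm_num))
      (ca.of_le (by norm_cast)) contDiff_const hsa HasCompactSupport.zero h)
      ((iD.const_mul _).add (iN.const_mul _)) fun x => ?_
    refine (crDensity_exp_mul_le hh.ne' (hv.differentiable (by norm_num) x)
      (χ1.differentiable (by norm_num) x) (hvφ x).2.1 (hvφ x).2.2).trans ?_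
    simp only [hsq_exp, ne_eq, OfNat.ofNat_ne_zero, not_false_eq_true, zero_pow, add_zero]
    refine add_le_add ?_ le_rfl
    rw [mul_assoc _ (Real.exp _)]
    by_cases hx : pd1 χ x ≠ 0 ∨ pd2 χ x ≠ 0
    · have hxt : x ∈ tsupport χ := by
        by_contra hc
        simp [pd1_eq_zero_of_notMem_tsupport hc, pd2_eq_zero_of_notMem_tsupport hc] at hx
      have h1 := hν x (hχR hxt) hx
      rw [← (hφψ x hxt).eq_of_nhds] at h1
      have h2 := (abs_le.1 (hvφ x).1).1
      have h3 : δ ≤ ε := min_le_left _ _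
      have : ν - ε ≤ v x := by linarith
      gcongr
    · push Not at hx
      simp [hx.1, hx.2]
  have hlow : Real.exp (-(2 * (μ + ε) / h)) * V ≤ N := by
    have hi : ∫ x, U.indicator (fun _ => Real.exp (-(2 * (μ + ε) / h))) x =
        Real.exp (-(2 * (μ + ε) / h)) * V := by
      rw [integral_indicator hU.measurableSet, setIntegral_const, smul_eq_mul, mul_comm]
    rw [← hi]
    refine integral_mono ((integrable_indicator_iff hU.measurableSet).2
      (integrableOn_const hUfin.ne)) iN fun x => ?_
    by_cases hx : x ∈ U
    · have h1 := hμ x hx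
      rw [← (hφψ x (hUs hx)).eq_of_nhds] at h1
      have h2 := (abs_le.1 (hvφ x).1).2
      have h3 : δ ≤ ε := min_le_left _ _
      have : v x ≤ μ + ε := by linarith
      simp only [indicator_of_mem hx, a, hU1 x hx, mul_one, hsq_exp]
      simp only [ne_eq, OfNat.ofNat_ne_zero, not_false_eq_true, zero_pow, add_zero]
      gcongr
    · simp only [indicator_of_notMem hx]; positivity
  have hδ2 : δ ^ 2 ≤ h ^ 2 * Real.exp (-(2 * (ν - μ - 2 * ε) / h)) := by
    calc δ ^ 2 ≤ (h * Real.exp (-((ν - μ) / h))) ^ 2 := by gcongr; exact min_le_right _ _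
      _ = h ^ 2 * Real.exp (-(2 * (ν - μ) / h)) := by
          rw [mul_pow, ← Real.exp_nat_mul]; congr 2; push_cast; ring
      _ ≤ _ := by
          refine mul_le_mul_of_nonneg_left (Real.exp_le_exp.2 (neg_le_neg ?_)) (sq_nonneg h)
          exact div_le_div_of_nonneg_right (by linarith) hh.le
  have hexp : Real.exp (-(2 * (ν - ε) / h)) =
      Real.exp (-(2 * (ν - μ - 2 * ε) / h)) * Real.exp (-(2 * (μ + ε) / h)) := by
    rw [← Real.exp_add]; congr 1; ring
  set e := Real.exp (-(2 * (ν - μ - 2 * ε) / h))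
  have hlow' : Real.exp (-(2 * (μ + ε) / h)) ≤ N / V := (le_div_iff₀ hVpos).2 hlow
  calc _ ≤ 2 * h ^ 2 * Real.exp (-(2 * (ν - ε) / h)) * D + 4 * δ ^ 2 * N := hup
    _ ≤ 2 * h ^ 2 * (e * (N / V)) * D + 4 * (h ^ 2 * e) * N := by rw [hexp]; gcongr
    _ = _ := by field_simp

end UpperBound

section RadialSymmetry

variable {R : ℝ} {ψ B w : ℝ × ℝ → ℝ}

lemma fderiv_fderiv_nonpos_of_isLocalMax {g : ℝ × ℝ → ℝ} {x : ℝ × ℝ} (hg : ContDiffAt ℝ 2 g x)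
    (hmax : IsLocalMax g x) (v : ℝ × ℝ) : fderiv ℝ (fun y => fderiv ℝ g y v) x v ≤ 0 := by
  by_contra! hpos
  set l : ℝ → ℝ × ℝ := fun t => x + t • v with hl
  have hl0 : l 0 = x := by simp [l]
  have hlc : Continuous l := by fun_prop
  have hlt : Tendsto l (𝓝 0) (𝓝 x) := by simpa [hl0] using hlc.tendsto 0
  have hld : ∀ t, HasDerivAt l v t := fun t => by
    have := ((hasDerivAt_id t).smul_const v).const_add x
    rwa [one_smul] at this
  set f : ℝ → ℝ := fun t => g (l t) with hf
  have hdf : deriv f =ᶠ[𝓝 0] fun t => fderiv ℝ g (l t) v := by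
    filter_upwards [hlt.eventually (hg.eventually (by norm_num))] with t ht
    exact ((ht.differentiableAt (by norm_num)).hasFDerivAt.comp_hasDerivAt t (hld t)).deriv
  have hd2 : DifferentiableAt ℝ (fun y => fderiv ℝ g y v) (l 0) := by
    rw [hl0]
    exact ((hg.fderiv_right (m := 1) (by norm_num)).differentiableAt (by norm_num)).clm_apply
      (differentiableAt_const v)
  have hddf : deriv (deriv f) 0 = fderiv ℝ (fun y => fderiv ℝ g y v) x v := by
    rw [hdf.deriv_eq, ← hl0]
    exact (hd2.hasFDerivAt.comp_hasDerivAt (0 : ℝ) (hld 0)).deriv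
  have hfmax : IsLocalMax f 0 := by
    have := hlt.eventually hmax
    filter_upwards [this] with t ht
    simpa [f, hl0] using ht
  have hfc : ContinuousAt f 0 :=
    ContinuousAt.comp (by rw [hl0]; exact hg.continuousAt) hlc.continuousAt
  have hfmin : IsLocalMin f 0 :=
    isLocalMin_of_deriv_deriv_pos (by rw [hddf]; exact hpos) hfmax.deriv_eq_zero hfc
  have hconst : f =ᶠ[𝓝 0] fun _ => f 0 := by
    filter_upwards [hfmax, hfmin] with t h1 h2 using le_antisymm h1 h2
  have : deriv (deriv f) 0 = 0 := by rw [hconst.deriv.deriv_eq]; simp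
  rw [hddf] at this
  exact hpos.ne' this

lemma lap_nonpos_of_isLocalMax {g : ℝ × ℝ → ℝ} {x : ℝ × ℝ} (hg : ContDiffAt ℝ 2 g x)
    (hmax : IsLocalMax g x) : lap g x ≤ 0 :=
  add_nonpos (fderiv_fderiv_nonpos_of_isLocalMax hg hmax (1, 0))
    (fderiv_fderiv_nonpos_of_isLocalMax hg hmax (0, 1))

lemma contDiffAt_of_contDiffOn_disc (hw : ContDiffOn ℝ 2 w (disc R)) {x : ℝ × ℝ}
    (hx : x ∈ disc R) : ContDiffAt ℝ 2 w x :=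
  hw.contDiffAt ((isOpen_disc R).mem_nhds hx)

lemma pd1_normSq (y : ℝ × ℝ) : pd1 (fun y : ℝ × ℝ => y.1 ^ 2 + y.2 ^ 2) y = 2 * y.1 := by
  have := ((hasFDerivAt_fst (𝕜 := ℝ) (p := y)).pow 2).add ((hasFDerivAt_snd (𝕜 := ℝ) (p := y)).pow 2)
  unfold pd1
  erw [this.fderiv]
  simp

lemma pd2_normSq (y : ℝ × ℝ) : pd2 (fun y : ℝ × ℝ => y.1 ^ 2 + y.2 ^ 2) y = 2 * y.2 := by
  have := ((hasFDerivAt_fst (𝕜 := ℝ) (p := y)).pow 2).add ((hasFDerivAt_snd (𝕜 := ℝ) (p := y)).pow 2)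
  unfold pd2
  erw [this.fderiv]
  simp

lemma pd_differentiableAt {g : ℝ × ℝ → ℝ} {x : ℝ × ℝ} (hg : ContDiffAt ℝ 2 g x) :
    DifferentiableAt ℝ (pd1 g) x ∧ DifferentiableAt ℝ (pd2 g) x := by
  have := (hg.fderiv_right (m := 1) (by norm_num)).differentiableAt (by norm_num)
  exact ⟨this.clm_apply (differentiableAt_const _), this.clm_apply (differentiableAt_const _)⟩

lemma lap_add {f g : ℝ × ℝ → ℝ} {x : ℝ × ℝ} (hf : ContDiffAt ℝ 2 f x) (hg : ContDiffAt ℝ 2 g x) :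
    lap (fun y => f y + g y) x = lap f x + lap g x := by
  have e : ∀ᶠ y in 𝓝 x, DifferentiableAt ℝ f y ∧ DifferentiableAt ℝ g y := by
    filter_upwards [hf.eventually (by norm_num), hg.eventually (by norm_num)] with y h1 h2
    exact ⟨h1.differentiableAt (by norm_num), h2.differentiableAt (by norm_num)⟩
  have e1 : pd1 (fun y => f y + g y) =ᶠ[𝓝 x] fun y => pd1 f y + pd1 g y :=
    e.mono fun y hy => pd1_add hy.1 hy.2
  have e2 : pd2 (fun y => f y + g y) =ᶠ[𝓝 x] fun y => pd2 f y + pd2 g y :=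
    e.mono fun y hy => pd2_add hy.1 hy.2
  obtain ⟨f1, f2⟩ := pd_differentiableAt hf
  obtain ⟨g1, g2⟩ := pd_differentiableAt hg
  unfold lap
  rw [pd1_congr e1, pd2_congr e2, pd1_add f1 g1, pd2_add f2 g2]
  ring

lemma lap_const_mul_normSq (ε : ℝ) (x : ℝ × ℝ) :
    lap (fun y : ℝ × ℝ => ε * (y.1 ^ 2 + y.2 ^ 2)) x = 4 * ε := by
  have e1 : pd1 (fun y : ℝ × ℝ => ε * (y.1 ^ 2 + y.2 ^ 2)) = fun y => ε * 2 * y.1 := by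
    funext y; rw [pd1_const_mul ε (by fun_prop), pd1_normSq]; ring
  have e2 : pd2 (fun y : ℝ × ℝ => ε * (y.1 ^ 2 + y.2 ^ 2)) = fun y => ε * 2 * y.2 := by
    funext y; rw [pd2_const_mul ε (by fun_prop), pd2_normSq]; ring
  unfold lap
  rw [e1, e2, pd1_const_mul _ (by fun_prop), pd2_const_mul _ (by fun_prop)]
  simp only [pd1, pd2]
  rw [hasFDerivAt_fst.fderiv, hasFDerivAt_snd.fderiv]
  simp
  ring

/-- The weak maximum principle for harmonic functions on a disc. -/
lemma nonpos_of_lap_eq_zero (hR : 0 < R) (hc : ContinuousOn w (closure (disc R)))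
    (hw : ContDiffOn ℝ 2 w (disc R)) (hlap : ∀ x ∈ disc R, lap w x = 0)
    (hb : ∀ x ∈ frontier (disc R), w x ≤ 0) {x : ℝ × ℝ} (hx : x ∈ closure (disc R)) :
    w x ≤ 0 := by
  have hcomp : IsCompact (closure (disc R)) := by
    rw [closure_disc hR]; exact isCompact_normSq_le _
  have main : ∀ ε > 0, w x ≤ ε * R ^ 2 := fun ε hε => by
    set g : ℝ × ℝ → ℝ := fun y => w y + ε * (y.1 ^ 2 + y.2 ^ 2) with hg
    obtain ⟨z, hz, hmax⟩ := hcomp.exists_isMaxOn ⟨x, hx⟩ (f := g) (hc.add (by fun_prop))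
    have hxz : g x ≤ g z := hmax hx
    have hzf : z ∈ frontier (disc R) := by
      rw [(isOpen_disc R).frontier_eq]
      refine ⟨hz, fun hzd => ?_⟩
      have hwz := contDiffAt_of_contDiffOn_disc hw hzd
      have hq : ContDiffAt ℝ 2 (fun y : ℝ × ℝ => ε * (y.1 ^ 2 + y.2 ^ 2)) z := by fun_prop
      have h1 := lap_nonpos_of_isLocalMax (g := g) (hwz.add hq)
        (hmax.isLocalMax (mem_of_superset ((isOpen_disc R).mem_nhds hzd) subset_closure))
      rw [hg, lap_add hwz hq, hlap z hzd, lap_const_mul_normSq] at h1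
      linarith
    have hwz := hb z hzf
    rw [frontier_disc hR] at hzf
    have hzR : z.1 ^ 2 + z.2 ^ 2 = R ^ 2 := hzf
    have h2 : g z ≤ ε * R ^ 2 := by simp only [g, hzR]; linarith
    have h3 : w x ≤ g x := le_add_of_nonneg_right (by positivity)
    linarith
  have hlim : Tendsto (fun ε : ℝ => ε * R ^ 2) (𝓝[>] 0) (𝓝 0) := by
    have : Continuous fun ε : ℝ => ε * R ^ 2 := by fun_prop
    simpa using (this.tendsto 0).mono_left nhdsWithin_le_nhds
  exact ge_of_tendsto hlim (eventually_mem_nhdsWithin.mono fun ε hε => main ε hε)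

/-- The linear map of the plane with matrix `(c, -s; s, c)`. -/
noncomputable def planeRotation (c s : ℝ) : ℝ × ℝ →L[ℝ] ℝ × ℝ :=
  (c • ContinuousLinearMap.fst ℝ ℝ ℝ - s • ContinuousLinearMap.snd ℝ ℝ ℝ).prod
    (s • ContinuousLinearMap.fst ℝ ℝ ℝ + c • ContinuousLinearMap.snd ℝ ℝ ℝ)

lemma planeRotation_apply (c s : ℝ) (x : ℝ × ℝ) :
    planeRotation c s x = (c * x.1 - s * x.2, s * x.1 + c * x.2) := by
  simp [planeRotation]

lemma normSq_planeRotation {c s : ℝ} (hcs : c ^ 2 + s ^ 2 = 1) (x : ℝ × ℝ) :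
    (planeRotation c s x).1 ^ 2 + (planeRotation c s x).2 ^ 2 = x.1 ^ 2 + x.2 ^ 2 := by
  simp only [planeRotation_apply]
  linear_combination (x.1 ^ 2 + x.2 ^ 2) * hcs

lemma pd1_comp_planeRotation (c s : ℝ) {x : ℝ × ℝ} (h : DifferentiableAt ℝ ψ (planeRotation c s x)) :
    pd1 (fun y => ψ (planeRotation c s y)) x =
      c * pd1 ψ (planeRotation c s x) + s * pd2 ψ (planeRotation c s x) := by
  unfold pd1 pd2
  rw [show fderiv ℝ (fun y => ψ (planeRotation c s y)) x = _ from
    (h.hasFDerivAt.comp x (planeRotation c s).hasFDerivAt).fderiv, ContinuousLinearMap.comp_apply,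
    show planeRotation c s (1, 0) = c • (1, 0) + s • (0, 1) by simp [planeRotation_apply],
    map_add, map_smul, map_smul, smul_eq_mul, smul_eq_mul]

lemma pd2_comp_planeRotation (c s : ℝ) {x : ℝ × ℝ} (h : DifferentiableAt ℝ ψ (planeRotation c s x)) :
    pd2 (fun y => ψ (planeRotation c s y)) x =
      (-s) * pd1 ψ (planeRotation c s x) + c * pd2 ψ (planeRotation c s x) := by
  unfold pd1 pd2
  rw [show fderiv ℝ (fun y => ψ (planeRotation c s y)) x = _ from
    (h.hasFDerivAt.comp x (planeRotation c s).hasFDerivAt).fderiv, ContinuousLinearMap.comp_apply,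
    show planeRotation c s (0, 1) = (-s) • (1, 0) + c • (0, 1) by simp [planeRotation_apply],
    map_add, map_smul, map_smul, smul_eq_mul, smul_eq_mul]

lemma lap_comp_planeRotation {c s : ℝ} (hcs : c ^ 2 + s ^ 2 = 1) {x : ℝ × ℝ}
    (hψ : ContDiffAt ℝ 2 ψ (planeRotation c s x)) :
    lap (fun y => ψ (planeRotation c s y)) x = lap ψ (planeRotation c s x) := by
  have ev : ∀ᶠ y in 𝓝 x, DifferentiableAt ℝ ψ (planeRotation c s y) := by
    filter_upwards [(planeRotation c s).continuous.continuousAt.eventually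
      (hψ.eventually (by norm_num))] with y hy using hy.differentiableAt (by norm_num)
  have e1 := ev.mono fun y hy => pd1_comp_planeRotation c s hy
  have e2 := ev.mono fun y hy => pd2_comp_planeRotation c s hy
  obtain ⟨d1, d2⟩ := pd_differentiableAt hψ
  have r1 : DifferentiableAt ℝ (fun y => pd1 ψ (planeRotation c s y)) x :=
    d1.comp x (planeRotation c s).differentiableAt
  have r2 : DifferentiableAt ℝ (fun y => pd2 ψ (planeRotation c s y)) x :=
    d2.comp x (planeRotation c s).differentiableAt
  unfold lap
  rw [pd1_congr e1, pd2_congr e2, pd1_add (r1.const_mul c) (r2.const_mul s),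
    pd2_add (r1.const_mul (-s)) (r2.const_mul c), pd1_const_mul _ r1, pd1_const_mul _ r2,
    pd2_const_mul _ r1, pd2_const_mul _ r2, pd1_comp_planeRotation c s d1, pd1_comp_planeRotation c s d2,
    pd2_comp_planeRotation c s d1, pd2_comp_planeRotation c s d2]
  linear_combination (pd1 (pd1 ψ) (planeRotation c s x) + pd2 (pd2 ψ) (planeRotation c s x)) * hcs

lemma comp_planeRotation_eq (hR : 0 < R) (hψ : IsScalarPotential (disc R) B ψ) {c s : ℝ}
    (hcs : c ^ 2 + s ^ 2 = 1) (hB : ∀ x ∈ disc R, B (planeRotation c s x) = B x) {x : ℝ × ℝ}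
    (hx : x ∈ closure (disc R)) : ψ (planeRotation c s x) = ψ x := by
  have m1 : ∀ y ∈ disc R, planeRotation c s y ∈ disc R := fun y (hy : y.1 ^ 2 + y.2 ^ 2 < R ^ 2) =>
    show _ < _ from (normSq_planeRotation hcs y).trans_lt hy
  have m2 : MapsTo (planeRotation c s) (closure (disc R)) (closure (disc R)) := by
    rw [closure_disc hR]
    exact fun y (hy : y.1 ^ 2 + y.2 ^ 2 ≤ R ^ 2) =>
      show _ ≤ _ from (normSq_planeRotation hcs y).trans_le hy
  have m3 : ∀ y ∈ frontier (disc R), planeRotation c s y ∈ frontier (disc R) := by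
    rw [frontier_disc hR]
    exact fun y (hy : y.1 ^ 2 + y.2 ^ 2 = R ^ 2) =>
      show _ = _ from (normSq_planeRotation hcs y).trans hy
  have c1 : ContinuousOn (fun y => ψ (planeRotation c s y)) (closure (disc R)) :=
    hψ.contOn.comp (planeRotation c s).continuous.continuousOn m2
  have c2 : ContDiffOn ℝ 2 (fun y => ψ (planeRotation c s y)) (disc R) :=
    hψ.c2.comp (planeRotation c s).contDiff.contDiffOn m1
  have hl : ∀ y ∈ disc R, lap (fun y => ψ (planeRotation c s y)) y = lap ψ y := fun y hy => by
    rw [lap_comp_planeRotation hcs (contDiffAt_of_contDiffOn_disc hψ.c2 (m1 y hy)),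
      hψ.lap_eq _ (m1 y hy), hψ.lap_eq y hy, hB y hy]
  have neg1 := hψ.c2.neg
  have neg2 := c2.neg
  refine le_antisymm ?_ ?_
  · have := nonpos_of_lap_eq_zero (w := fun y => ψ (planeRotation c s y) + -ψ y) hR
      (c1.add hψ.contOn.neg) (c2.add neg1) (fun y hy => ?_) (fun y hy => ?_) hx
    · linarith
    · rw [lap_add (contDiffAt_of_contDiffOn_disc c2 hy) (contDiffAt_of_contDiffOn_disc neg1 hy),
        hl y hy, lap_neg, add_neg_cancel]
    · rw [hψ.bdry _ (m3 y hy), hψ.bdry y hy]; simp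
  · have := nonpos_of_lap_eq_zero (w := fun y => ψ y + -ψ (planeRotation c s y)) hR
      (hψ.contOn.add c1.neg) (hψ.c2.add neg2) (fun y hy => ?_) (fun y hy => ?_) hx
    · linarith
    · rw [lap_add (contDiffAt_of_contDiffOn_disc hψ.c2 hy) (contDiffAt_of_contDiffOn_disc neg2 hy),
        lap_neg, hl y hy, add_neg_cancel]
    · rw [hψ.bdry _ (m3 y hy), hψ.bdry y hy]; simp

/-- The scalar potential of a radial field on a disc is radial. -/
lemma IsScalarPotential.eq_radial (hR : 0 < R) (hψ : IsScalarPotential (disc R) B ψ) {b : ℝ → ℝ}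
    (hB : ∀ x ∈ closure (disc R), B x = b (Real.sqrt (x.1 ^ 2 + x.2 ^ 2))) {x : ℝ × ℝ}
    (hx : x ∈ closure (disc R)) : ψ x = ψ (Real.sqrt (x.1 ^ 2 + x.2 ^ 2), 0) := by
  set r := Real.sqrt (x.1 ^ 2 + x.2 ^ 2) with hr
  have hr2 : r ^ 2 = x.1 ^ 2 + x.2 ^ 2 := Real.sq_sqrt (by positivity)
  rcases eq_or_ne r 0 with h0 | h0
  · have h1 : x.1 = 0 := by nlinarith [sq_nonneg x.1, sq_nonneg x.2]
    have h2 : x.2 = 0 := by nlinarith [sq_nonneg x.1, sq_nonneg x.2]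
    rw [h0]; congr 1; exact Prod.ext h1 h2
  · have hcs : (x.1 / r) ^ 2 + (x.2 / r) ^ 2 = 1 := by field_simp; exact hr2.symm
    have hrx : planeRotation (x.1 / r) (x.2 / r) (r, 0) = x := by
      rw [planeRotation_apply]
      ext <;> simp [h0]
    have hmem : (r, (0 : ℝ)) ∈ closure (disc R) := by
      rw [closure_disc hR] at hx ⊢
      have hx' : x.1 ^ 2 + x.2 ^ 2 ≤ R ^ 2 := hx
      show r ^ 2 + (0 : ℝ) ^ 2 ≤ R ^ 2
      linarith
    rw [← comp_planeRotation_eq hR hψ hcs (fun y hy => ?_) hmem, hrx]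
    rw [hB y (subset_closure hy), hB _ (subset_closure ?_), normSq_planeRotation hcs]
    exact show _ < _ from (normSq_planeRotation hcs y).trans_lt hy

end RadialSymmetry

section Limit

lemma mul_log_mul_sq_mul_exp {C h a : ℝ} (hC : 0 < C) (hh : 0 < h) :
    h * Real.log (C * h ^ 2 * Real.exp (-(2 * a / h))) =
      h * Real.log C + 2 * (h * Real.log h) - 2 * a := by
  rw [Real.log_mul (by positivity) (by positivity), Real.log_mul hC.ne' (by positivity),
    Real.log_exp, Real.log_pow]
  field_simp
  push_cast
  ring

lemma tendsto_mul_log_of_exp_bounds {F : ℝ → ℝ} {a c : ℝ} (hc : 0 < c)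
    (hlow : ∀ h > 0, c * h ^ 2 * Real.exp (-(2 * a / h)) ≤ F h)
    (hup : ∀ δ > 0, ∃ C > 0, ∀ h > 0, F h ≤ C * h ^ 2 * Real.exp (-(2 * (a - δ) / h))) :
    Tendsto (fun h => h * Real.log (F h)) (𝓝[>] 0) (𝓝 (-(2 * a))) := by
  have hlim : ∀ C d : ℝ, Tendsto (fun h : ℝ => h * Real.log C + 2 * (h * Real.log h) - 2 * d)
      (𝓝[>] 0) (𝓝 (-(2 * d))) := fun C d => by
    have hcont : Continuous fun h : ℝ => h * Real.log C + 2 * (h * Real.log h) - 2 * d := by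
      have := Real.continuous_mul_log
      fun_prop
    simpa using (hcont.tendsto 0).mono_left nhdsWithin_le_nhds
  have hpos : ∀ h > 0, 0 < F h := fun h hh => lt_of_lt_of_le (by positivity) (hlow h hh)
  refine tendsto_order.2 ⟨fun l hl => ?_, fun l hl => ?_⟩
  · filter_upwards [(hlim c a).eventually (lt_mem_nhds hl), self_mem_nhdsWithin] with h h1 h2
    have hh : 0 < h := h2
    rw [← mul_log_mul_sq_mul_exp hc hh] at h1
    exact h1.trans_le (mul_le_mul_of_nonneg_left
      (Real.log_le_log (by positivity) (hlow h hh)) hh.le)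
  · obtain ⟨δ, hδ, hδl⟩ : ∃ δ > 0, -(2 * (a - δ)) < l := ⟨(l + 2 * a) / 4, by linarith, by linarith⟩
    obtain ⟨C, hC, hCup⟩ := hup δ hδ
    filter_upwards [(hlim C (a - δ)).eventually (gt_mem_nhds hδl), self_mem_nhdsWithin] with h h1 h2
    have hh : 0 < h := h2
    rw [← mul_log_mul_sq_mul_exp hC hh] at h1
    exact (mul_le_mul_of_nonneg_left
      (Real.log_le_log (hpos h hh) (hCup h hh)) hh.le).trans_lt h1

end Limit

section Radial

variable {R : ℝ} {ψ B : ℝ × ℝ → ℝ}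

lemma mk_zero_mem_closure_disc (hR : 0 < R) {r : ℝ} (hr : r ∈ Icc 0 R) :
    (r, (0 : ℝ)) ∈ closure (disc R) := by
  rw [closure_disc hR]
  have := pow_le_pow_left₀ hr.1 hr.2 2
  show r ^ 2 + (0 : ℝ) ^ 2 ≤ R ^ 2
  linarith

lemma sqrt_normSq_mem_Icc (hR : 0 < R) {x : ℝ × ℝ} (hx : x ∈ closure (disc R)) :
    Real.sqrt (x.1 ^ 2 + x.2 ^ 2) ∈ Icc 0 R := by
  rw [closure_disc hR] at hx
  exact ⟨Real.sqrt_nonneg _, Real.sqrt_le_iff.2 ⟨hR.le, hx⟩⟩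

/-- Exponential upper bound on the spin-down energy of a radial potential whose radial profile
attains the value `m` before the value `M`. -/
lemma exists_lambdaMinusD_le_of_radial (hR : 0 < R) (hc : ContinuousOn ψ (closure (disc R)))
    (hψ : ContDiffOn ℝ 2 ψ (disc R)) (hB : ∀ x ∈ disc R, lap ψ x = B x)
    (hrad : ∀ x ∈ closure (disc R), ψ x = ψ (Real.sqrt (x.1 ^ 2 + x.2 ^ 2), 0)) {m M : ℝ}
    (hm : ∀ x ∈ disc R, m ≤ ψ x) (hM : ∀ x ∈ disc R, ψ x ≤ M) {r s : ℝ} (hr : r ∈ Icc 0 R)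
    (hs : s ∈ Icc 0 R) (hrs : r < s) (hψr : ψ (r, 0) = m) (hψs : ψ (s, 0) = M) {δ : ℝ}
    (hδ : 0 < δ) :
    ∃ C > 0, ∀ h > 0, lambdaMinusD h (perpGrad ψ) B (disc R) ≤
      C * h ^ 2 * Real.exp (-(2 * (M - m - 4 * δ) / h)) := by
  have hf : ContinuousOn (fun t : ℝ => ψ (t, 0)) (Icc 0 R) :=
    hc.comp (by fun_prop) fun t ht => mk_zero_mem_closure_disc hR ht
  obtain ⟨η, hη, hηf⟩ := Metric.continuousOn_iff.1 hf s hs δ hδ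
  obtain ⟨t₁, h1, h1s⟩ := exists_between (max_lt hrs (show s - η < s by linarith))
  obtain ⟨t₂, h12, h2s⟩ := exists_between h1s
  have hr1 : r < t₁ := (le_max_left _ _).trans_lt h1
  have hη1 : s - η < t₁ := (le_max_right _ _).trans_lt h1
  have ht1 : 0 < t₁ := hr.1.trans_lt hr1
  have hsq : t₁ ^ 2 < t₂ ^ 2 := pow_lt_pow_left₀ h12 ht1.le two_ne_zero
  have h2R : t₂ ^ 2 < R ^ 2 := pow_lt_pow_left₀ (h2s.trans_le hs.2) (ht1.trans h12).le two_ne_zero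
  have hsub : disc t₁ ⊆ disc R := by
    intro x (hx : x.1 ^ 2 + x.2 ^ 2 < t₁ ^ 2)
    show x.1 ^ 2 + x.2 ^ 2 < R ^ 2
    linarith
  have hts := tsupport_radialCutoff_subset hsq
  have hν : ∀ x ∈ disc R, pd1 (radialCutoff (t₁ ^ 2) (t₂ ^ 2)) x ≠ 0 ∨
      pd2 (radialCutoff (t₁ ^ 2) (t₂ ^ 2)) x ≠ 0 → M - δ ≤ ψ x := by
    intro x hx hne
    have hx2 : x.1 ^ 2 + x.2 ^ 2 ≤ t₂ ^ 2 := by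
      by_contra hlt
      have : x ∉ tsupport (radialCutoff (t₁ ^ 2) (t₂ ^ 2)) := fun h => hlt (hts h)
      simp [pd1_eq_zero_of_notMem_tsupport this, pd2_eq_zero_of_notMem_tsupport this] at hne
    have hx1 : t₁ ^ 2 ≤ x.1 ^ 2 + x.2 ^ 2 := by
      by_contra! hlt
      have := radialCutoff_eventuallyEq_one hsq hlt
      rw [pd1_congr this, pd2_congr this] at hne
      simp [pd1, pd2] at hne
    have hxc := subset_closure hx
    have hq1 := Real.le_sqrt_of_sq_le hx1
    have hq2 : Real.sqrt (x.1 ^ 2 + x.2 ^ 2) ≤ t₂ := Real.sqrt_le_iff.2 ⟨(ht1.trans h12).le, hx2⟩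
    have := hηf _ (sqrt_normSq_mem_Icc hR hxc) (by
      rw [Real.dist_eq, abs_lt]; constructor <;> linarith)
    rw [← hrad x hxc, hψs, Real.dist_eq, abs_lt] at this
    linarith
  obtain ⟨C, hC, hCle⟩ := exists_lambdaMinusD_le hR hψ hB hm hM (contDiff_radialCutoff _ _)
    ((isCompact_normSq_le _).of_isClosed_subset (isClosed_tsupport _) hts)
    (fun x hx => show x.1 ^ 2 + x.2 ^ 2 < R ^ 2 from
      lt_of_le_of_lt (show x.1 ^ 2 + x.2 ^ 2 ≤ t₂ ^ 2 from hts hx) h2R) hν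
    ((hψ.continuousOn.mono hsub).isOpen_inter_preimage (isOpen_disc t₁) (isOpen_Iio (a := m + δ)))
    ⟨(r, 0), show r ^ 2 + (0 : ℝ) ^ 2 < t₁ ^ 2 by
        simpa using pow_lt_pow_left₀ hr1 hr.1 two_ne_zero,
      show ψ (r, 0) < m + δ by linarith⟩
    (fun x hx => radialCutoff_eq_one hsq (le_of_lt hx.1)) (fun x hx => le_of_lt hx.2) hδ
  refine ⟨C, hC, fun h hh => (hCle h hh).trans (le_of_eq ?_)⟩
  congr 5
  ring

lemma sSup_image_disc_eq (hc : ContinuousOn ψ (closure (disc R))) {M : ℝ}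
    (hM : ∀ x ∈ disc R, ψ x ≤ M) {z : ℝ × ℝ} (hz : z ∈ closure (disc R)) (hzM : ψ z = M) :
    sSup (ψ '' disc R) = M := by
  have hmem : M ∈ closure (ψ '' disc R) := hc.image_closure ⟨z, hz, hzM⟩
  exact (isLUB_of_mem_closure (by rintro _ ⟨x, hx, rfl⟩; exact hM x hx) hmem).csSup_eq
    (closure_nonempty_iff.1 ⟨M, hmem⟩)

lemma sInf_image_disc_eq (hc : ContinuousOn ψ (closure (disc R))) {m : ℝ}
    (hm : ∀ x ∈ disc R, m ≤ ψ x) {z : ℝ × ℝ} (hz : z ∈ closure (disc R)) (hzm : ψ z = m) :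
    sInf (ψ '' disc R) = m := by
  have hmem : m ∈ closure (ψ '' disc R) := hc.image_closure ⟨z, hz, hzm⟩
  exact (isGLB_of_mem_closure (by rintro _ ⟨x, hx, rfl⟩; exact hm x hx) hmem).csInf_eq
    (closure_nonempty_iff.1 ⟨m, hmem⟩)

end Radial

/-- Theorem 5.1 / `thm-radial`: for a continuous radial magnetic
field on the disc `D(0,R)`, `lim_{h→0⁺} h·log Λ^D(h,B,D(0,R)) = −2·Osc ψ₀`. -/
theorem pauli_full_lim_radial (R : ℝ) (hRpos : 0 < R) (b : ℝ → ℝ)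
    (hb : ContinuousOn b (Icc 0 R)) (B ψ₀ : ℝ × ℝ → ℝ)
    (hBrad : ∀ x ∈ closure (disc R), B x = b (Real.sqrt (x.1 ^ 2 + x.2 ^ 2)))
    (hBcont : ContinuousOn B (closure (disc R)))
    (hψ : IsScalarPotential (disc R) B ψ₀) :
    Tendsto (fun h : ℝ => h * Real.log (LambdaD h (perpGrad ψ₀) B (disc R))) (𝓝[>] 0)
      (𝓝 (-(2 * osc ψ₀ (disc R)))) := by
  have hc := hψ.contOn
  have hrad := fun x hx => hψ.eq_radial hRpos hBrad (x := x) hx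
  have hf : ContinuousOn (fun t : ℝ => ψ₀ (t, 0)) (Icc 0 R) :=
    hc.comp (by fun_prop) fun t ht => mk_zero_mem_closure_disc hRpos ht
  obtain ⟨r, hr, hmin⟩ := isCompact_Icc.exists_isMinOn (nonempty_Icc.2 hRpos.le) hf
  obtain ⟨s, hs, hmax⟩ := isCompact_Icc.exists_isMaxOn (nonempty_Icc.2 hRpos.le) hf
  set m := ψ₀ (r, 0) with hm_def
  set M := ψ₀ (s, 0) with hM_def
  have hm : ∀ x ∈ disc R, m ≤ ψ₀ x := fun x hx => by
    rw [hrad x (subset_closure hx)]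
    exact hmin (sqrt_normSq_mem_Icc hRpos (subset_closure hx))
  have hM : ∀ x ∈ disc R, ψ₀ x ≤ M := fun x hx => by
    rw [hrad x (subset_closure hx)]
    exact hmax (sqrt_normSq_mem_Icc hRpos (subset_closure hx))
  have hosc : osc ψ₀ (disc R) = M - m := by
    rw [osc, sSup_image_disc_eq hc hM (mk_zero_mem_closure_disc hRpos hs) rfl,
      sInf_image_disc_eq hc hm (mk_zero_mem_closure_disc hRpos hr) rfl]
  have hlap_neg : ∀ x ∈ disc R, lap (fun y => -ψ₀ y) x = -B x := fun x hx => by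
    rw [lap_neg, hψ.lap_eq x hx]
  have hm' : ∀ x ∈ disc R, -M ≤ -ψ₀ x := fun x hx => neg_le_neg (hM x hx)
  have hM' : ∀ x ∈ disc R, -ψ₀ x ≤ -m := fun x hx => neg_le_neg (hm x hx)
  rw [hosc]
  refine tendsto_mul_log_of_exp_bounds (c := 1 / (4 * R ^ 2)) (by positivity) (fun h hh => ?_)
    fun δ hδ => ?_
  · refine le_min ?_ ?_
    · refine (le_of_eq ?_).trans (le_lambdaMinusD hRpos hψ.c2 hψ.lap_eq hm hM hh)
      ring
    · rw [lambdaPlusD_eq_lambdaMinusD_neg]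
      refine (le_of_eq ?_).trans (le_lambdaMinusD hRpos hψ.c2.neg hlap_neg hm' hM' hh)
      rw [show -m - -M = M - m by ring]
      ring
  · have hδ4 : 0 < δ / 4 := by positivity
    have down : ∀ r ∈ Icc 0 R, ∀ s ∈ Icc 0 R, r < s → ψ₀ (r, 0) = m → ψ₀ (s, 0) = M →
        ∃ C > 0, ∀ h > 0, LambdaD h (perpGrad ψ₀) B (disc R) ≤
          C * h ^ 2 * Real.exp (-(2 * (M - m - δ) / h)) := by
      intro r hr s hs hrs h1 h2
      obtain ⟨C, hC, hle⟩ := exists_lambdaMinusD_le_of_radial hRpos hc hψ.c2 hψ.lap_eq hrad hm hM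
        hr hs hrs h1 h2 hδ4
      refine ⟨C, hC, fun h hh => (min_le_left _ _).trans ((hle h hh).trans (le_of_eq ?_))⟩
      rw [mul_div_cancel₀ δ four_ne_zero]
    rcases lt_trichotomy r s with hrs | rfl | hsr
    · exact down r hr s hs hrs rfl rfl
    · have hconst : ∀ t ∈ Icc 0 R, ψ₀ (t, 0) = m := fun t ht => le_antisymm (hmax ht) (hmin ht)
      exact down 0 (left_mem_Icc.2 hRpos.le) R (right_mem_Icc.2 hRpos.le) hRpos
        (hconst 0 (left_mem_Icc.2 hRpos.le)) (hconst R (right_mem_Icc.2 hRpos.le))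
    · obtain ⟨C, hC, hle⟩ := exists_lambdaMinusD_le_of_radial hRpos hc.neg hψ.c2.neg hlap_neg
        (fun x hx => congrArg Neg.neg (hrad x hx)) hm' hM' hs hr hsr rfl rfl hδ4
      refine ⟨C, hC, fun h hh => (min_le_right _ _).trans ?_⟩
      rw [lambdaPlusD_eq_lambdaMinusD_neg]
      refine (hle h hh).trans (le_of_eq ?_)
      rw [mul_div_cancel₀ δ four_ne_zero, show -m - -M = M - m by ring]
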